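/- For M ∈ v let j_M = {η ∈ v : tr([M, η]·X) = 0 for all X ∈ so(n)_A}, and let F_M ⊆ v be the real linear span of the orthogonal projections onto v of the matrices π((M + λA)^j), λ ∈ ℝ, j ∈ ℕ (the gradients on v of the restricted Manakov integrals tr((M+λA)^k), M ∈ v). Then there is an open dense subset U ⊆ v such that for every M ∈ U: F_M ⊆ j_M and {η ∈ j_M : tr(M·[ξ, η]) = 0 for all ξ ∈ F_M} = F_M. (This expresses that the restricted Manakov integrals L_v form a complete commutative subset of the algebra of Ad_{SO(n)_A}-invariant polynomials on v, equivalently of the SO(n)-invariant functions on T*(SO(n)/SO(k_1)×⋯×SO(k_r)); Theorem 3(i) of the paper, valid for every choice of k_1,…,k_r.) -/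

import Mathlib

open Matrix

/-- The skew-symmetric part `π(P) = (P − Pᵀ)/2` of a matrix. -/
noncomputable def skewPart {n : ℕ} (P : Matrix (Fin n) (Fin n) ℝ) :
    Matrix (Fin n) (Fin n) ℝ :=
  (1 / 2 : ℝ) • (P - Pᵀ)

/-- The subspace `v`: skew-symmetric matrices whose diagonal blocks (with respect to
the block decomposition given by `blk`) vanish — the orthogonal complement of
`so(n)_A` in `so(n)`. -/
def vSet {n r : ℕ} (blk : Fin n → Fin r) : Set (Matrix (Fin n) (Fin n) ℝ) :=
  {X | Xᵀ = -X ∧ ∀ i j, blk i = blk j → X i j = 0}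

/-- The orthogonal projection onto `v`: kill the diagonal blocks. -/
def projV {n r : ℕ} (blk : Fin n → Fin r) (X : Matrix (Fin n) (Fin n) ℝ) :
    Matrix (Fin n) (Fin n) ℝ :=
  Matrix.of fun i j => if blk i = blk j then 0 else X i j

/-- The gradients on `v` of the restricted Manakov integrals `tr((M + λA)^k)`,
`M ∈ v`: the projections onto `v` of `π((M + λA)^j)`. -/
noncomputable def restrictedManakovGradients {n r : ℕ} (blk : Fin n → Fin r)
    (A M : Matrix (Fin n) (Fin n) ℝ) : Set (Matrix (Fin n) (Fin n) ℝ) :=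
  {P | ∃ (lam : ℝ) (j : ℕ), P = projV blk (skewPart ((M + lam • A) ^ j))}

/-- `j_M = {η ∈ v : tr([M, η]·X) = 0 for all X ∈ so(n)_A}`. -/
def jSet {n r : ℕ} (blk : Fin n → Fin r) (A M : Matrix (Fin n) (Fin n) ℝ) :
    Set (Matrix (Fin n) (Fin n) ℝ) :=
  {η | η ∈ vSet blk ∧ ∀ X : Matrix (Fin n) (Fin n) ℝ, Xᵀ = -X → X * A = A * X →
      ((M * η - η * M) * X).trace = 0}


namespace RMC

/-- Krylov matrix: columns `L^j u`. -/
def kry {S : Type*} [CommRing S] {n : ℕ} (L : Matrix (Fin n) (Fin n) S) (u : Fin n → S) :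
    Matrix (Fin n) (Fin n) S := Matrix.of fun i j => ((L ^ (j : ℕ)) *ᵥ u) i

lemma kry_mulVec_single {S : Type*} [CommRing S] {n : ℕ} (L : Matrix (Fin n) (Fin n) S)
    (u : Fin n → S) (j : Fin n) : kry L u *ᵥ Pi.single j 1 = (L ^ (j : ℕ)) *ᵥ u := by
  ext i
  simp [kry]

lemma mem_adjoin_of_commute {n : ℕ} (N Y : Matrix (Fin n) (Fin n) ℝ) (u : Fin n → ℝ)
    (hK : IsUnit (kry N u).det) (h : N * Y = Y * N) : Y ∈ Algebra.adjoin ℝ {N} := by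
  set c : Fin n → ℝ := (kry N u)⁻¹ *ᵥ (Y *ᵥ u) with hc
  have h1 : kry N u *ᵥ c = Y *ᵥ u := by
    rw [hc, Matrix.mulVec_mulVec, Matrix.mul_nonsing_inv _ hK, Matrix.one_mulVec]
  set Q : Matrix (Fin n) (Fin n) ℝ := ∑ j : Fin n, c j • N ^ (j : ℕ) with hQ
  have hQu : Q *ᵥ u = Y *ᵥ u := by
    rw [← h1, hQ, Matrix.sum_mulVec]
    ext i
    simp [Matrix.mulVec, dotProduct, kry, Finset.mul_sum, mul_comm, mul_assoc]
  have hQN : N * Q = Q * N := by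
    rw [hQ, Finset.mul_sum, Finset.sum_mul]
    refine Finset.sum_congr rfl fun j _ => ?_
    rw [Matrix.mul_smul, Matrix.smul_mul, ← pow_succ, ← pow_succ']
  have hcomm : ∀ (W : Matrix (Fin n) (Fin n) ℝ), N * W = W * N → ∀ j : ℕ, W * N ^ j = N ^ j * W := by
    intro W hW j
    exact ((show Commute N W from hW).pow_left j).symm.eq
  have hYQ : Y * kry N u = Q * kry N u := by
    apply Matrix.ext_of_mulVec_single
    intro j
    rw [← Matrix.mulVec_mulVec, ← Matrix.mulVec_mulVec, kry_mulVec_single, Matrix.mulVec_mulVec,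
      Matrix.mulVec_mulVec, hcomm Y h, hcomm Q hQN, ← Matrix.mulVec_mulVec, ← Matrix.mulVec_mulVec, hQu]
  have : Y = Q := by
    have := congrArg (· * (kry N u)⁻¹) hYQ
    simpa [Matrix.mul_assoc, Matrix.mul_nonsing_inv _ hK] using this
  rw [this, hQ]
  refine Subalgebra.sum_mem _ fun j _ => Subalgebra.smul_mem _ (Subalgebra.pow_mem _ (Algebra.self_mem_adjoin_singleton ℝ N) _) _

/-- recursion solving the commutator equation on a Krylov basis -/
def zrec {S : Type*} [CommRing S] {n : ℕ} (L R : Matrix (Fin n) (Fin n) S) (u : Fin n → S) :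
    ℕ → (Fin n → S)
  | 0 => 0
  | (j + 1) => L *ᵥ zrec L R u j - R *ᵥ ((L ^ j) *ᵥ u)

lemma exists_commutator {S : Type*} [CommRing S] {n : ℕ} (L R : Matrix (Fin n) (Fin n) S)
    (u : Fin n → S) (hK : IsUnit (kry L u).det) (h : ∀ j : ℕ, (R * L ^ j).trace = 0) :
    ∃ Z : Matrix (Fin n) (Fin n) S, L * Z - Z * L = R := by
  set K := kry L u with hKdef
  set Z : Matrix (Fin n) (Fin n) S := (Matrix.of fun i (j : Fin n) => zrec L R u j i) * K⁻¹ with hZ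
  have hZK : ∀ j : Fin n, Z *ᵥ ((L ^ (j : ℕ)) *ᵥ u) = zrec L R u j := by
    intro j
    rw [← kry_mulVec_single, Matrix.mulVec_mulVec, hZ, Matrix.mul_assoc, ← hKdef,
      Matrix.nonsing_inv_mul _ hK, Matrix.mul_one]
    ext i; simp
  clear_value Z
  set R' := R - (L * Z - Z * L) with hR'
  have h1 : ∀ j : ℕ, j + 1 < n → R' *ᵥ ((L ^ j) *ᵥ u) = 0 := by
    intro j hj
    have e1 := hZK ⟨j, by omega⟩
    have e2 := hZK ⟨j + 1, hj⟩
    simp only at e1 e2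
    rw [hR', Matrix.sub_mulVec, Matrix.sub_mulVec, ← Matrix.mulVec_mulVec, ← Matrix.mulVec_mulVec, e1]
    rw [pow_succ', ← Matrix.mulVec_mulVec] at e2
    rw [e2, zrec]
    abel
  have htr : ∀ j : ℕ, (R' * L ^ j).trace = 0 := by
    intro j
    rw [hR', Matrix.sub_mul, Matrix.trace_sub, h j, Matrix.sub_mul, Matrix.trace_sub]
    have : (L * Z * L ^ j).trace = (Z * L * L ^ j).trace := by
      rw [Matrix.mul_assoc, Matrix.trace_mul_comm, Matrix.mul_assoc, Matrix.mul_assoc, ← pow_succ, ← pow_succ']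
    rw [this]; simp
  -- conjugated matrix
  set P := K⁻¹ * R' * K with hP
  have hPcol : ∀ i j : Fin n, (j : ℕ) + 1 < n → P i j = 0 := by
    intro i j hj
    have : P *ᵥ Pi.single j 1 = 0 := by
      rw [hP, ← Matrix.mulVec_mulVec, kry_mulVec_single, ← Matrix.mulVec_mulVec, h1 j hj, Matrix.mulVec_zero]
    have := congrFun this i
    simpa using this
  set D : ℕ → Matrix (Fin n) (Fin n) S := fun s => K⁻¹ * L ^ s * K with hD
  have hDcol : ∀ s : ℕ, ∀ i j : Fin n, ∀ h : (j : ℕ) + s < n, D s i j = if i = ⟨j + s, h⟩ then 1 else 0 := by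
    intro s i j hj
    have : D s *ᵥ Pi.single j 1 = Pi.single ⟨j + s, hj⟩ 1 := by
      rw [hD]; simp only
      rw [← Matrix.mulVec_mulVec, kry_mulVec_single, Matrix.mulVec_mulVec, Matrix.mul_assoc, ← pow_add,
        ← Matrix.mulVec_mulVec]
      have e := kry_mulVec_single L u ⟨j + s, hj⟩
      simp only at e
      rw [add_comm s, ← e, Matrix.mulVec_mulVec, ← hKdef, Matrix.nonsing_inv_mul _ hK, Matrix.one_mulVec]
    have := congrFun this i
    rw [Matrix.mulVec_single_one] at this
    simpa [Pi.single_apply] using this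
  have htrP : ∀ s, (P * D s).trace = 0 := by
    intro s
    have : P * D s = K⁻¹ * (R' * L ^ s) * K := by
      rw [hP, hD]
      simp only [Matrix.mul_assoc]
      rw [← Matrix.mul_assoc K K⁻¹, Matrix.mul_nonsing_inv _ hK, Matrix.one_mul]
    rw [this, Matrix.trace_mul_comm, ← Matrix.mul_assoc, Matrix.mul_nonsing_inv _ hK, Matrix.one_mul, htr]
  have hP0 : P = 0 := by
    rcases Nat.eq_zero_or_pos n with rfl | hn
    · ext i; exact i.elim0
    have key : ∀ s : ℕ, ∀ hs : s < n, P ⟨n - 1 - s, by omega⟩ ⟨n - 1, by omega⟩ = 0 := by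
      intro s
      induction s using Nat.strong_induction_on with
      | _ s ih =>
        intro hs
        have e := htrP s
        have e2 : (P * D s).trace = ∑ i, P i ⟨n - 1, by omega⟩ * D s ⟨n - 1, by omega⟩ i := by
          simp only [Matrix.trace, Matrix.diag, Matrix.mul_apply]
          refine Finset.sum_congr rfl fun i _ => ?_
          refine Finset.sum_eq_single_of_mem _ (Finset.mem_univ _) fun k _ hk => ?_
          rw [hPcol i k, zero_mul]
          have : (k : ℕ) ≠ n - 1 := fun h => hk (Fin.ext h)
          omega
        rw [e2, Finset.sum_eq_single_of_mem (⟨n - 1 - s, by omega⟩ : Fin n) (Finset.mem_univ _)] at e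
        · rw [hDcol s _ _ (by simp only; omega), if_pos (Fin.ext (by simp only; omega)), mul_one] at e
          exact e
        · intro k _ hk
          have hk' : (k : ℕ) ≠ n - 1 - s := fun h => hk (Fin.ext h)
          rcases lt_or_gt_of_ne hk' with hlt | hgt
          · rw [hDcol s _ k (by omega), if_neg, mul_zero]
            intro h; have := congrArg Fin.val h; simp only at this; omega
          · have := ih (n - 1 - k) (by omega) (by omega)
            have hkk : (⟨n - 1 - (n - 1 - k), by omega⟩ : Fin n) = k := Fin.ext (by simp only; omega)
            rw [hkk] at this
            rw [this, zero_mul]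
    ext i j
    by_cases hj : (j : ℕ) + 1 < n
    · simp [hPcol i j hj]
    · have := key (n - 1 - i) (by omega)
      have h1 : (⟨n - 1 - (n - 1 - i), by omega⟩ : Fin n) = i := Fin.ext (by simp only; omega)
      have h2 : (⟨n - 1, by omega⟩ : Fin n) = j := Fin.ext (by simp only; omega)
      rw [h1, h2] at this
      simpa using this
  have hR0 : R' = 0 := by
    have : K * P * K⁻¹ = R' := by
      rw [hP]
      simp only [Matrix.mul_assoc]
      rw [Matrix.mul_nonsing_inv _ hK, Matrix.mul_one, ← Matrix.mul_assoc, Matrix.mul_nonsing_inv _ hK, Matrix.one_mul]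
    rw [← this, hP0]; simp
  exact ⟨Z, (sub_eq_zero.mp hR0).symm⟩

/-- Tridiagonal (unreduced Hessenberg) matrices are cyclic. -/
lemma kry_hessenberg {S : Type*} [CommRing S] {n : ℕ} (hn : 0 < n) (L : Matrix (Fin n) (Fin n) S)
    (h0 : ∀ i j : Fin n, (j : ℕ) + 1 < i → L i j = 0)
    (h1 : ∀ i j : Fin n, (i : ℕ) = j + 1 → IsUnit (L i j)) :
    IsUnit (kry L (Pi.single ⟨0, hn⟩ 1)).det := by
  set u : Fin n → S := Pi.single ⟨0, hn⟩ 1 with hu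
  have A1 : ∀ s : ℕ, ∀ i : Fin n, s < i → ((L ^ s) *ᵥ u) i = 0 := by
    intro s
    induction s with
    | zero => 
      intro i hi
      have : i ≠ ⟨0, hn⟩ := fun h => by have := congrArg Fin.val h; simp only at this; omega
      simp [hu, Pi.single_apply, this]
    | succ s ih =>
      intro i hi
      rw [pow_succ', ← Matrix.mulVec_mulVec]
      simp only [Matrix.mulVec, dotProduct]
      refine Finset.sum_eq_zero fun k _ => ?_
      by_cases hk : s < k
      · have := ih k hk
        simp only [Matrix.mulVec, dotProduct] at this
        rw [this, mul_zero]
      · rw [h0 i k (by omega), zero_mul]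
  have A2 : ∀ s : ℕ, ∀ hs : s < n, IsUnit (((L ^ s) *ᵥ u) ⟨s, hs⟩) := by
    intro s
    induction s with
    | zero => intro hs; simp [hu]
    | succ s ih =>
      intro hs
      rw [pow_succ', ← Matrix.mulVec_mulVec]
      have : (L *ᵥ (L ^ s *ᵥ u)) ⟨s + 1, hs⟩ = L ⟨s + 1, hs⟩ ⟨s, by omega⟩ * (L ^ s *ᵥ u) ⟨s, by omega⟩ := by
        rw [Matrix.mulVec, dotProduct]
        refine Finset.sum_eq_single_of_mem _ (Finset.mem_univ _) fun k _ hk => ?_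
        have hk' : (k : ℕ) ≠ s := fun h => hk (Fin.ext h)
        rcases lt_or_gt_of_ne hk' with hlt | hgt
        · rw [h0 _ k (by simp only; omega), zero_mul]
        · rw [A1 s k hgt, mul_zero]
      rw [this]
      exact (h1 _ _ rfl).mul (ih _)
  rw [Matrix.det_of_isUpperTriangular]
  · rw [IsUnit.prod_univ_iff]
    intro i
    exact A2 i i.2
  · intro i j hij
    exact A1 j i hij

end RMC

namespace RMC

/-- in-block part -/
def bp {n r : ℕ} (blk : Fin n → Fin r) :
    Matrix (Fin n) (Fin n) ℝ →ₗ[ℝ] Matrix (Fin n) (Fin n) ℝ where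
  toFun X := Matrix.of fun i j => if blk i = blk j then X i j else 0
  map_add' X Y := by ext i j; by_cases h : blk i = blk j <;> simp [h]
  map_smul' c X := by ext i j; by_cases h : blk i = blk j <;> simp [h]

lemma bp_apply {n r : ℕ} (blk : Fin n → Fin r) (X : Matrix (Fin n) (Fin n) ℝ) (i j : Fin n) :
    bp blk X i j = if blk i = blk j then X i j else 0 := rfl

section
variable {n r : ℕ} {blk : Fin n → Fin r} {α : Fin r → ℝ} {A : Matrix (Fin n) (Fin n) ℝ}

lemma comm_iff (hα : Function.Injective α) (hA : A = Matrix.diagonal fun i => α (blk i))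
    (Y : Matrix (Fin n) (Fin n) ℝ) :
    A * Y = Y * A ↔ ∀ i j, blk i ≠ blk j → Y i j = 0 := by
  subst hA
  constructor
  · intro h i j hij
    have := congrFun (congrFun h i) j
    rw [Matrix.diagonal_mul, Matrix.mul_diagonal] at this
    have h2 : α (blk i) - α (blk j) ≠ 0 := sub_ne_zero.mpr fun h => hij (hα h)
    have h3 : (α (blk i) - α (blk j)) * Y i j = 0 := by linarith
    exact (mul_eq_zero.mp h3).resolve_left h2
  · intro h
    ext i j
    rw [Matrix.diagonal_mul, Matrix.mul_diagonal]
    by_cases hij : blk i = blk j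
    · rw [hij, mul_comm]
    · rw [h i j hij]; simp

lemma bp_of_comm (hα : Function.Injective α) (hA : A = Matrix.diagonal fun i => α (blk i))
    {Y : Matrix (Fin n) (Fin n) ℝ} (h : A * Y = Y * A) : bp blk Y = Y := by
  rw [comm_iff hα hA] at h
  ext i j
  rw [bp_apply]
  split_ifs with hij
  · rfl
  · exact (h i j hij).symm

lemma bp_comm (hα : Function.Injective α) (hA : A = Matrix.diagonal fun i => α (blk i))
    (Y : Matrix (Fin n) (Fin n) ℝ) : A * bp blk Y = bp blk Y * A := by
  rw [comm_iff hα hA]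
  intro i j hij
  rw [bp_apply, if_neg hij]

lemma bp_mul_left (hα : Function.Injective α) (hA : A = Matrix.diagonal fun i => α (blk i))
    {B : Matrix (Fin n) (Fin n) ℝ} (h : A * B = B * A) (X : Matrix (Fin n) (Fin n) ℝ) :
    bp blk (B * X) = B * bp blk X := by
  rw [comm_iff hα hA] at h
  ext i j
  rw [bp_apply, Matrix.mul_apply, Matrix.mul_apply]
  split_ifs with hij
  · refine Finset.sum_congr rfl fun k _ => ?_
    rw [bp_apply]
    by_cases hk : blk i = blk k
    · rw [if_pos (hk.symm.trans hij)]
    · rw [h i k hk]; simp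
  · symm
    refine Finset.sum_eq_zero fun k _ => ?_
    rw [bp_apply]
    by_cases hk : blk i = blk k
    · rw [if_neg (by rwa [← hk]), mul_zero]
    · rw [h i k hk]; simp

lemma bp_mul_right (hα : Function.Injective α) (hA : A = Matrix.diagonal fun i => α (blk i))
    {B : Matrix (Fin n) (Fin n) ℝ} (h : A * B = B * A) (X : Matrix (Fin n) (Fin n) ℝ) :
    bp blk (X * B) = bp blk X * B := by
  rw [comm_iff hα hA] at h
  ext i j
  rw [bp_apply, Matrix.mul_apply, Matrix.mul_apply]
  split_ifs with hij
  · refine Finset.sum_congr rfl fun k _ => ?_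
    rw [bp_apply]
    by_cases hk : blk k = blk j
    · rw [if_pos (hij.trans hk.symm)]
    · rw [h k j hk]; simp
  · symm
    refine Finset.sum_eq_zero fun k _ => ?_
    rw [bp_apply]
    by_cases hk : blk k = blk j
    · rw [if_neg (by rwa [hk]), zero_mul]
    · rw [h k j hk]; simp

lemma bp_adA (hA : A = Matrix.diagonal fun i => α (blk i))
    (X : Matrix (Fin n) (Fin n) ℝ) : bp blk (A * X - X * A) = 0 := by
  subst hA
  ext i j
  rw [bp_apply, Matrix.sub_apply, Matrix.diagonal_mul, Matrix.mul_diagonal]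
  split_ifs with hij
  · rw [hij]; simp [mul_comm]
  · rfl

/-- inverse of `ad A` -/
noncomputable def gM (blk : Fin n → Fin r) (α : Fin r → ℝ) (M : Matrix (Fin n) (Fin n) ℝ) :
    Matrix (Fin n) (Fin n) ℝ := Matrix.of fun i j => M i j / (α (blk i) - α (blk j))

/-- second-order perturbation matrix -/
noncomputable def nM (blk : Fin n → Fin r) (α : Fin r → ℝ) (M : Matrix (Fin n) (Fin n) ℝ) :
    Matrix (Fin n) (Fin n) ℝ := - bp blk (M * gM blk α M)

lemma adA_gM (hα : Function.Injective α) (hA : A = Matrix.diagonal fun i => α (blk i))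
    {M : Matrix (Fin n) (Fin n) ℝ} (hM : ∀ i j, blk i = blk j → M i j = 0) :
    A * gM blk α M - gM blk α M * A = M := by
  subst hA
  ext i j
  rw [Matrix.sub_apply, Matrix.diagonal_mul, Matrix.mul_diagonal, gM, Matrix.of_apply]
  by_cases hij : blk i = blk j
  · rw [hM i j hij]; simp
  · have h2 : α (blk i) - α (blk j) ≠ 0 := sub_ne_zero.mpr fun h => hij (hα h)
    field_simp

lemma bp_M {M : Matrix (Fin n) (Fin n) ℝ} (hM : ∀ i j, blk i = blk j → M i j = 0) :
    bp blk M = 0 := by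
  ext i j
  rw [bp_apply]
  split_ifs with hij
  · exact hM i j hij
  · rfl

/-- the key commutation: first obstruction at infinity -/
lemma nM_comm (hα : Function.Injective α) (hA : A = Matrix.diagonal fun i => α (blk i))
    {M : Matrix (Fin n) (Fin n) ℝ} (hM : ∀ i j, blk i = blk j → M i j = 0)
    {Y0 Y1 : Matrix (Fin n) (Fin n) ℝ} (h0 : A * Y0 = Y0 * A)
    (h1 : A * Y1 - Y1 * A + (M * Y0 - Y0 * M) = 0)
    (h2 : bp blk (M * Y1 - Y1 * M) = 0) :
    nM blk α M * Y0 = Y0 * nM blk α M := by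
  have hG := adA_gM hα hA hM
  set G := gM blk α M with hGdef
  -- D = Y1 + [G, Y0] commutes with A
  have hD : A * (Y1 + (G * Y0 - Y0 * G)) = (Y1 + (G * Y0 - Y0 * G)) * A := by
    rw [← sub_eq_zero]
    calc _ = A * Y1 - Y1 * A + ((A * G - G * A) * Y0 - Y0 * (A * G - G * A))
          + (G * (A * Y0 - Y0 * A) - (A * Y0 - Y0 * A) * G) := by noncomm_ring
      _ = 0 := by rw [hG, h1, h0]; simp
  have e1 : bp blk (M * (Y1 + (G * Y0 - Y0 * G)) - (Y1 + (G * Y0 - Y0 * G)) * M) = 0 := by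
    rw [map_sub, bp_mul_right hα hA hD, bp_mul_left hα hA hD, bp_M hM]; simp
  have e2 : bp blk (M * Y0 * G + G * Y0 * M) = 0 := by
    have := bp_adA hA (G * Y0 * G)
    rw [← this]
    congr 1
    calc _ = (A * G - G * A) * Y0 * G + G * Y0 * (A * G - G * A) := by rw [hG]
      _ = A * (G * Y0 * G) - G * Y0 * G * A - G * (A * Y0 - Y0 * A) * G := by noncomm_ring
      _ = _ := by rw [h0]; simp
  have e4 : bp blk (G * M) = - bp blk (M * G) := by
    have := bp_adA hA (G * G)
    have h : A * (G * G) - G * G * A = M * G + G * M := by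
      calc _ = (A * G - G * A) * G + G * (A * G - G * A) := by noncomm_ring
        _ = _ := by rw [hG]
    rw [h, map_add] at this
    exact eq_neg_of_add_eq_zero_right this
  have e3 : bp blk (M * (Y1 + (G * Y0 - Y0 * G)) - (Y1 + (G * Y0 - Y0 * G)) * M)
      = bp blk (M * Y1 - Y1 * M) + bp blk (M * G * Y0) + bp blk (Y0 * (G * M))
        - bp blk (M * Y0 * G + G * Y0 * M) := by
    rw [← map_add, ← map_add, ← map_sub]
    congr 1
    noncomm_ring
  rw [e1, h2, e2, bp_mul_right hα hA h0, bp_mul_left hα hA h0, e4] at e3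
  unfold nM
  rw [← hGdef]
  simp only [zero_add, sub_zero, mul_neg, neg_mul] at e3 ⊢
  rw [neg_inj]
  exact (sub_eq_zero.mp (by rw [sub_eq_add_neg]; exact e3.symm))

end

end RMC

namespace RMC
open Polynomial

/-- evaluation of a matrix polynomial at a real scalar -/
noncomputable def ev {n : ℕ} (μ : ℝ) :
    (Matrix (Fin n) (Fin n) ℝ)[X] →ₐ[ℝ] Matrix (Fin n) (Fin n) ℝ :=
  ((Polynomial.aeval μ : ℝ[X] →ₐ[ℝ] ℝ).mapMatrix).comp
    (matPolyEquiv (R := ℝ) (n := Fin n)).symm.toAlgHom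

lemma ev_eq_sum {n : ℕ} (μ : ℝ) (P : (Matrix (Fin n) (Fin n) ℝ)[X]) :
    ev μ P = ∑ k ∈ Finset.range (P.natDegree + 1), μ ^ k • P.coeff k := by
  have h := matPolyEquiv_symm_map_eval P μ
  have h2 : ev μ P = (matPolyEquiv.symm P).map (eval μ) := by
    ext i j
    simp [ev, Polynomial.aeval_def, Polynomial.eval₂_eq_eval_map]
  rw [h2, h, Polynomial.eval_eq_sum_range]
  refine Finset.sum_congr rfl fun k _ => ?_
  rw [← map_pow]
  ext i j
  simp [Matrix.scalar_apply, mul_comm]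

lemma ev_C {n : ℕ} (μ : ℝ) (B : Matrix (Fin n) (Fin n) ℝ) : ev μ (C B) = B := by
  rw [ev_eq_sum]; simp

lemma ev_X {n : ℕ} (μ : ℝ) : ev μ (X : (Matrix (Fin n) (Fin n) ℝ)[X]) = μ • 1 := by
  rcases subsingleton_or_nontrivial (Matrix (Fin n) (Fin n) ℝ) with h | h
  · exact Subsingleton.elim _ _
  rw [ev_eq_sum]; simp [Finset.sum_range_succ]

lemma coeff_mem {n : ℕ} (W : Submodule ℝ (Matrix (Fin n) (Fin n) ℝ))
    (P : (Matrix (Fin n) (Fin n) ℝ)[X]) (h : ∀ μ : ℝ, μ ≠ 0 → ev μ P ∈ W) (i : ℕ) :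
    P.coeff i ∈ W := by
  by_contra hi
  obtain ⟨f, hf, hW⟩ := Submodule.exists_le_ker_of_notMem hi
  set q : ℝ[X] := ∑ k ∈ Finset.range (P.natDegree + 1), monomial k (f (P.coeff k)) with hq
  have hq0 : q = 0 := by
    apply Polynomial.eq_zero_of_infinite_isRoot
    refine Set.Infinite.mono (s := {0}ᶜ) ?_ (Set.Finite.infinite_compl (Set.finite_singleton _))
    intro μ hμ
    have := hW (h μ hμ)
    rw [LinearMap.mem_ker, ev_eq_sum, map_sum] at this
    simp only [Set.mem_ofPred_eq, IsRoot.def, hq, Polynomial.eval_finsetSum, eval_monomial]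
    rw [← this]
    refine Finset.sum_congr rfl fun k _ => ?_
    rw [map_smul, smul_eq_mul, mul_comm]
  have h1 : q.coeff i = f (P.coeff i) := by
    simp only [hq, Polynomial.finsetSum_coeff, coeff_monomial]
    rw [Finset.sum_ite_eq' ]
    split_ifs with hh
    · rfl
    · rw [Polynomial.coeff_eq_zero_of_natDegree_lt, map_zero]
      simpa using hh
  rw [hq0] at h1
  exact hf (by rw [← h1]; simp)

/-- the pencil at infinity -/
noncomputable def pen {n : ℕ} (A M : Matrix (Fin n) (Fin n) ℝ) :
    (Matrix (Fin n) (Fin n) ℝ)[X] := C A + X * C M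

lemma ev_pen {n : ℕ} (A M : Matrix (Fin n) (Fin n) ℝ) (μ : ℝ) : ev μ (pen A M) = A + μ • M := by
  rw [pen, map_add, map_mul, ev_C, ev_C, ev_X]; simp

/-- families that are polynomial in the pencil for each parameter -/
noncomputable def CC {n : ℕ} (A M : Matrix (Fin n) (Fin n) ℝ) :
    Subalgebra ℝ ((Matrix (Fin n) (Fin n) ℝ)[X]) :=
  ⨅ μ : {μ : ℝ // μ ≠ 0}, (Algebra.adjoin ℝ {A + μ.1 • M}).comap (ev μ.1)

lemma mem_CC {n : ℕ} {A M : Matrix (Fin n) (Fin n) ℝ} {P : (Matrix (Fin n) (Fin n) ℝ)[X]} :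
    P ∈ CC A M ↔ ∀ μ : ℝ, μ ≠ 0 → ev μ P ∈ Algebra.adjoin ℝ {A + μ • M} := by
  simp [CC, Algebra.mem_iInf]

lemma pen_mem {n : ℕ} (A M : Matrix (Fin n) (Fin n) ℝ) : pen A M ∈ CC A M := by
  rw [mem_CC]
  intro μ _
  rw [ev_pen]
  exact Algebra.self_mem_adjoin_singleton ℝ _

lemma X_mem {n : ℕ} (A M : Matrix (Fin n) (Fin n) ℝ) : X ∈ CC A M := by
  rw [mem_CC]
  intro μ _
  rw [ev_X]
  exact Subalgebra.smul_mem _ (Subalgebra.one_mem _) _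

lemma of_X_mul {n : ℕ} {A M : Matrix (Fin n) (Fin n) ℝ} {P : (Matrix (Fin n) (Fin n) ℝ)[X]}
    (h : X * P ∈ CC A M) : P ∈ CC A M := by
  rw [mem_CC] at h ⊢
  intro μ hμ
  have := h μ hμ
  rw [map_mul, ev_X, smul_mul_assoc, one_mul] at this
  have h2 := Subalgebra.smul_mem _ this μ⁻¹
  rwa [smul_smul, inv_mul_cancel₀ hμ, one_smul] at h2

lemma CC_comm {n : ℕ} {A M : Matrix (Fin n) (Fin n) ℝ} {P : (Matrix (Fin n) (Fin n) ℝ)[X]}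
    (h : P ∈ CC A M) : pen A M * P - P * pen A M = 0 := by
  rw [mem_CC] at h
  ext1 i
  rw [coeff_zero]
  have := coeff_mem ⊥ (pen A M * P - P * pen A M) (fun μ hμ => ?_) i
  · simpa using this
  · rw [Submodule.mem_bot, map_sub, map_mul, map_mul, ev_pen, sub_eq_zero]
    exact (Algebra.commute_of_mem_adjoin_self (h μ hμ)).eq

/-- leading coefficients -/
noncomputable def BB {n : ℕ} (A M : Matrix (Fin n) (Fin n) ℝ) :
    Subalgebra ℝ (Matrix (Fin n) (Fin n) ℝ) := (CC A M).map (ev 0)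

lemma ev_zero {n : ℕ} (P : (Matrix (Fin n) (Fin n) ℝ)[X]) : ev 0 P = P.coeff 0 := by
  rw [ev_eq_sum, Finset.sum_eq_single_of_mem 0 (by simp)]
  · simp
  · intro b _ hb; simp [hb]

lemma mem_BB {n : ℕ} {A M B : Matrix (Fin n) (Fin n) ℝ} :
    B ∈ BB A M ↔ ∃ P ∈ CC A M, P.coeff 0 = B := by
  simp [BB, Subalgebra.mem_map, ev_zero]

lemma A_mem_BB {n : ℕ} (A M : Matrix (Fin n) (Fin n) ℝ) : A ∈ BB A M :=
  mem_BB.mpr ⟨pen A M, pen_mem A M, by simp [pen]⟩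

lemma pen_comm_coeff_zero {n : ℕ} (A M : Matrix (Fin n) (Fin n) ℝ)
    (P : (Matrix (Fin n) (Fin n) ℝ)[X]) :
    (pen A M * P - P * pen A M).coeff 0 = A * P.coeff 0 - P.coeff 0 * A := by
  simp [pen, mul_coeff_zero]

lemma pen_comm_coeff_succ {n : ℕ} (A M : Matrix (Fin n) (Fin n) ℝ)
    (P : (Matrix (Fin n) (Fin n) ℝ)[X]) (i : ℕ) :
    (pen A M * P - P * pen A M).coeff (i + 1) =
      A * P.coeff (i + 1) - P.coeff (i + 1) * A + (M * P.coeff i - P.coeff i * M) := by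
  rw [pen, X_mul]
  simp only [coeff_sub, add_mul, mul_add, coeff_add, coeff_C_mul, coeff_mul_C]
  rw [mul_assoc, X_mul, ← mul_assoc, ← mul_assoc, coeff_mul_X, coeff_mul_X, coeff_C_mul, coeff_mul_C]
  abel

lemma exists_X_mul {n : ℕ} {P : (Matrix (Fin n) (Fin n) ℝ)[X]} (h : P.coeff 0 = 0) :
    ∃ Q, P = X * Q :=
  ⟨P.divX, by conv_lhs => rw [← X_mul_divX_add P, h, C_0, add_zero]⟩

section
variable {n r : ℕ} {blk : Fin n → Fin r} {α : Fin r → ℝ} {A : Matrix (Fin n) (Fin n) ℝ}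

/-- block projector -/
def pj (blk : Fin n → Fin r) (p : Fin r) : Matrix (Fin n) (Fin n) ℝ :=
  Matrix.diagonal fun i => if blk i = p then 1 else 0

lemma pj_mem (hα : Function.Injective α) (hA : A = Matrix.diagonal fun i => α (blk i)) (p : Fin r) :
    pj blk p ∈ Algebra.adjoin ℝ {A} := by
  have : pj blk p = aeval A (Lagrange.basis Finset.univ α p) := by
    rw [hA]
    have : (Matrix.diagonal fun i => α (blk i)) = Matrix.diagonalAlgHom ℝ (fun i => α (blk i)) := rfl
    rw [this, Polynomial.aeval_algHom_apply]
    rw [pj, Matrix.diagonalAlgHom_apply]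
    congr 1
    ext i
    rw [Polynomial.aeval_pi_apply₂, Polynomial.coe_aeval_eq_eval]
    split_ifs with h
    · rw [h, Lagrange.eval_basis_self hα.injOn (Finset.mem_univ _)]
    · rw [Lagrange.eval_basis_of_ne (Ne.symm h) (Finset.mem_univ _)]
  rw [this]
  exact Polynomial.aeval_mem_adjoin_singleton ℝ A

lemma nM_mem (hα : Function.Injective α) (hA : A = Matrix.diagonal fun i => α (blk i))
    {M : Matrix (Fin n) (Fin n) ℝ} (hM : ∀ i j, blk i = blk j → M i j = 0) :
    nM blk α M ∈ BB A M := by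
  have hsum : nM blk α M = ∑ p, pj blk p * nM blk α M := by
    rw [← Finset.sum_mul]
    have : ∑ p, pj blk p = 1 := by
      ext i j
      rw [Matrix.sum_apply]
      by_cases hij : i = j
      · subst hij; simp [pj]
      · simp [pj, hij]
    rw [this, one_mul]
  rw [hsum]
  refine Subalgebra.sum_mem _ fun p _ => ?_
  set P := pj blk p with hP
  have hAP : A * P = P * A := by
    rw [comm_iff hα hA]
    intro i j hij
    rw [hP, pj, Matrix.diagonal_apply_ne]
    rintro rfl; exact hij rfl
  have hPP : P * P = P := by
    rw [hP, pj, Matrix.diagonal_mul_diagonal]; congr 1; ext i; split_ifs <;> simp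
  have hPMP : P * M * P = 0 := by
    ext i j
    rw [hP, pj, Matrix.mul_diagonal, Matrix.diagonal_mul]
    by_cases h : blk i = blk j
    · rw [hM i j h]; simp
    · by_cases hi : blk i = p
      · have : ¬ blk j = p := fun hj => h (hi.trans hj.symm)
        simp [this]
      · simp [hi]
  have hAp : P * (A - α p • 1) = 0 := by
    rw [hP, pj, hA]
    ext i j
    rw [Matrix.diagonal_mul]
    by_cases hi : blk i = p
    · by_cases hij : i = j
      · subst hij; simp [hi]
      · simp [hij]
    · simp [hi]
  have hAp' : (A - α p • 1) * P = 0 := by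
    rw [← hAp, sub_mul, mul_sub, hAP]; simp
  have hAA : A * (A - α p • 1) = (A - α p • 1) * A := by simp [sub_mul, mul_sub]
  obtain ⟨c, hc, hc0⟩ := mem_BB.mp
    (Algebra.adjoin_le (Set.singleton_subset_iff.mpr (A_mem_BB A M)) (pj_mem hα hA p))
  rw [← hP] at hc0
  -- first step
  have hH : (pen A M - C (α p • 1)) * c ∈ CC A M := by
    refine mul_mem (sub_mem (pen_mem A M) ?_) hc
    have : (C (α p • (1 : Matrix (Fin n) (Fin n) ℝ))) = algebraMap ℝ _ (α p) := by
      rw [← Algebra.algebraMap_eq_smul_one]; rfl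
    rw [this]
    exact Subalgebra.algebraMap_mem _ _
  set a' := A - α p • (1 : Matrix (Fin n) (Fin n) ℝ) with ha'
  have hpen' : pen A M - C (α p • 1) = C a' + X * C M := by
    rw [pen, ha', C_sub]; abel
  rw [hpen'] at hH
  obtain ⟨H, hHeq⟩ := exists_X_mul (P := (C a' + X * C M) * c) (by
    simp [mul_coeff_zero, hc0, hAp'])
  rw [hHeq] at hH
  have hHC := of_X_mul hH
  have hHcoeff : ∀ i, H.coeff i = a' * c.coeff (i + 1) + M * c.coeff i := by
    intro i
    have := congrArg (fun Q => Q.coeff (i + 1)) hHeq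
    simp only [coeff_X_mul] at this
    rw [← this, add_mul, coeff_add, coeff_C_mul, mul_assoc, coeff_X_mul, coeff_C_mul]
  have comm0 : ∀ Q ∈ CC A M, A * Q.coeff 0 = Q.coeff 0 * A := by
    intro Q hQ
    have := congrArg (fun Q => Q.coeff 0) (CC_comm hQ)
    simp only [pen_comm_coeff_zero, coeff_zero] at this
    exact sub_eq_zero.mp this
  have hH0 : P * H.coeff 0 = 0 := by
    have h1 := bp_of_comm hα hA (comm0 H hHC)
    rw [← h1, ← bp_mul_left hα hA hAP, hHcoeff, hc0, mul_add, ← mul_assoc, hAp, zero_mul, zero_add,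
      ← mul_assoc, hPMP, map_zero]
  obtain ⟨J, hJeq⟩ := exists_X_mul (P := c * H) (by rw [mul_coeff_zero, hc0, hH0])
  have hJC : J ∈ CC A M := of_X_mul (by rw [← hJeq]; exact mul_mem hc hHC)
  have hJ0 : J.coeff 0 = P * H.coeff 1 + c.coeff 1 * H.coeff 0 := by
    have := congrArg (fun Q => Q.coeff 1) hJeq
    simp only [mul_coeff_one, hc0] at this
    rw [this]; simp
  have hc1 : A * c.coeff 1 - c.coeff 1 * A + (M * P - P * M) = 0 := by
    have := congrArg (fun Q => Q.coeff (0 + 1)) (CC_comm hc)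
    simp only [pen_comm_coeff_succ, coeff_zero, hc0] at this
    simpa using this
  have hG := adA_gM hα hA hM
  set G := gM blk α M with hGdef
  have hD : A * (c.coeff 1 + (G * P - P * G)) = (c.coeff 1 + (G * P - P * G)) * A := by
    rw [← sub_eq_zero]
    calc _ = A * c.coeff 1 - c.coeff 1 * A + ((A * G - G * A) * P - P * (A * G - G * A))
          + (G * (A * P - P * A) - (A * P - P * A) * G) := by noncomm_ring
      _ = 0 := by rw [hG, hc1, hAP]; simp
  have hfin : P * J.coeff 0 = P * nM blk α M := by
    have h1 := bp_of_comm hα hA (comm0 J hJC)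
    have hcH := comm0 H hHC
    have e1 : bp blk (c.coeff 1 * H.coeff 0) = bp blk (c.coeff 1) * H.coeff 0 :=
      bp_mul_right hα hA hcH _
    have hPb : P * bp blk (c.coeff 1) = bp blk (c.coeff 1) * P := by
      ext i j
      rw [hP, pj, Matrix.diagonal_mul, Matrix.mul_diagonal, bp_apply]
      by_cases hij : blk i = blk j
      · simp [hij]
      · simp [hij]
    have e2 : P * (a' * c.coeff 2 + M * c.coeff 1) = P * (M * c.coeff 1) := by
      rw [mul_add, ← mul_assoc, hAp, zero_mul, zero_add]
    have e3 : c.coeff 1 = (c.coeff 1 + (G * P - P * G)) - (G * P - P * G) := by abel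
    have e4 : bp blk (M * (c.coeff 1 + (G * P - P * G))) = 0 := by
      rw [bp_mul_right hα hA hD, bp_M hM, zero_mul]
    have hNc : A * nM blk α M = nM blk α M * A := by
      rw [nM, mul_neg, neg_mul, bp_comm hα hA]
    have hPN : P * bp blk (M * G) * P = P * bp blk (M * G) := by
      have : P * bp blk (M * G) = bp blk (M * G) * P := by
        ext i j
        rw [hP, pj, Matrix.diagonal_mul, Matrix.mul_diagonal, bp_apply]
        by_cases hij : blk i = blk j
        · simp [hij]
        · simp [hij]
      rw [this, mul_assoc, hPP]
    rw [← h1, hJ0, map_add, mul_add, e1, ← mul_assoc, hPb, mul_assoc, hH0, mul_zero, add_zero,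
      bp_mul_left hα hA hAP, ← mul_assoc, hPP, hHcoeff, ← bp_mul_left hα hA hAP, e2,
      bp_mul_left hα hA hAP]
    rw [e3, mul_sub, map_sub, e4, zero_sub, mul_neg, ← bp_mul_left hα hA hAP]
    have e5 : P * (M * (G * P - P * G)) = P * (M * G) * P := by
      calc _ = P * (M * G) * P - P * M * P * G := by noncomm_ring
        _ = _ := by rw [hPMP]; simp
    rw [e5, bp_mul_right hα hA hAP, bp_mul_left hα hA hAP, hPN, nM, mul_neg]
  rw [← hfin]
  refine mul_mem (mem_BB.mpr ⟨c, hc, hc0⟩) (mem_BB.mpr ⟨J, hJC, rfl⟩)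

end
end RMC

namespace RMC
open Polynomial

/-- pointwise completeness -/
def SS {n r : ℕ} (blk : Fin n → Fin r) (A M : Matrix (Fin n) (Fin n) ℝ) : Prop :=
  ∀ η ∈ jSet blk A M, (∀ (lam : ℝ) (j : ℕ), ((M * η - η * M) * (M + lam • A) ^ j).trace = 0) →
    η ∈ Submodule.span ℝ (restrictedManakovGradients blk A M)

/-- `projV ∘ skewPart` as a linear map -/
noncomputable def qv {n r : ℕ} (blk : Fin n → Fin r) :
    Matrix (Fin n) (Fin n) ℝ →ₗ[ℝ] Matrix (Fin n) (Fin n) ℝ where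
  toFun X := projV blk (skewPart X)
  map_add' X Y := by
    ext i j
    by_cases h : blk i = blk j
    · simp [projV, skewPart, h]
    · simp [projV, skewPart, h]; ring
  map_smul' c X := by
    ext i j
    by_cases h : blk i = blk j
    · simp [projV, skewPart, h]
    · simp [projV, skewPart, h]; ring

lemma qv_apply {n r : ℕ} (blk : Fin n → Fin r) (X : Matrix (Fin n) (Fin n) ℝ) (i j : Fin n) :
    qv blk X i j = if blk i = blk j then 0 else (X i j - X j i) / 2 := by
  simp [qv, projV, skewPart]
  split_ifs <;> ring

section
variable {n r : ℕ} {blk : Fin n → Fin r} {α : Fin r → ℝ} {A : Matrix (Fin n) (Fin n) ℝ}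

lemma qv_of_mem {η : Matrix (Fin n) (Fin n) ℝ} (h : η ∈ vSet blk) : qv blk η = η := by
  ext i j
  rw [qv_apply]
  split_ifs with hij
  · exact (h.2 i j hij).symm
  · have := congrFun (congrFun h.1 i) j
    simp only [Matrix.transpose_apply, Matrix.neg_apply] at this
    rw [this]; ring

lemma qv_mem (X : Matrix (Fin n) (Fin n) ℝ) : qv blk X ∈ vSet blk := by
  refine ⟨?_, fun i j h => by rw [qv_apply, if_pos h]⟩
  ext i j
  rw [Matrix.transpose_apply, Matrix.neg_apply, qv_apply, qv_apply]
  by_cases h : blk i = blk j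
  · simp [h]
  · rw [if_neg h, if_neg (Ne.symm h)]; ring

lemma qv_of_comm (hα : Function.Injective α) (hA : A = Matrix.diagonal fun i => α (blk i))
    {Y : Matrix (Fin n) (Fin n) ℝ} (h : A * Y = Y * A) : qv blk Y = 0 := by
  rw [comm_iff hα hA] at h
  ext i j
  rw [qv_apply]
  split_ifs with hij
  · rfl
  · rw [h i j hij, h j i (Ne.symm hij)]; simp

lemma qv_adjoin {M Q : Matrix (Fin n) (Fin n) ℝ} {lam : ℝ} (h : Q ∈ Algebra.adjoin ℝ {M + lam • A}) :
    qv blk Q ∈ Submodule.span ℝ (restrictedManakovGradients blk A M) := by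
  rw [Algebra.adjoin_singleton_eq_range_aeval] at h
  obtain ⟨p, rfl⟩ := h
  change qv blk (aeval (M + lam • A) p) ∈ _
  rw [Polynomial.aeval_eq_sum_range, map_sum]
  refine Submodule.sum_mem _ fun k _ => ?_
  rw [map_smul]
  exact Submodule.smul_mem _ _ (Submodule.subset_span ⟨lam, k, rfl⟩)

lemma skew_comm {M η : Matrix (Fin n) (Fin n) ℝ} (hM : Mᵀ = -M) (hη : ηᵀ = -η) :
    (M * η - η * M)ᵀ = -(M * η - η * M) := by
  rw [Matrix.transpose_sub, Matrix.transpose_mul, Matrix.transpose_mul, hM, hη]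
  simp

lemma bp_j (hα : Function.Injective α) (hA : A = Matrix.diagonal fun i => α (blk i))
    {M η : Matrix (Fin n) (Fin n) ℝ} (hM : M ∈ vSet blk) (hη : η ∈ jSet blk A M) :
    bp blk (M * η - η * M) = 0 := by
  have hs := skew_comm hM.1 hη.1.1
  set R := M * η - η * M with hR
  have hs' : ∀ i j, R j i = - R i j := fun i j => by
    have := congrFun (congrFun hs i) j
    simpa using this
  have hb : ∀ i j, bp blk R j i = - bp blk R i j := fun i j => by
    rw [bp_apply, bp_apply]
    by_cases h : blk i = blk j
    · rw [if_pos h, if_pos h.symm, hs']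
    · rw [if_neg h, if_neg (Ne.symm h)]; simp
  have h1 := hη.2 (bp blk R) (by ext i j; exact hb i j) (bp_comm hα hA R).symm
  rw [← hR] at h1
  have h2 : (R * bp blk R).trace = - ∑ i, ∑ j, (bp blk R i j) ^ 2 := by
    simp only [Matrix.trace, Matrix.diag, Matrix.mul_apply]
    rw [← Finset.sum_neg_distrib]
    refine Finset.sum_congr rfl fun i _ => ?_
    rw [← Finset.sum_neg_distrib]
    refine Finset.sum_congr rfl fun j _ => ?_
    rw [hb i j, bp_apply]
    split_ifs <;> ring
  rw [h2, neg_eq_zero] at h1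
  have h1 := (Finset.sum_eq_zero_iff_of_nonneg (f := fun i => ∑ j, (bp blk R i j) ^ 2)
    (fun i _ => Finset.sum_nonneg fun j _ => sq_nonneg _)).mp h1
  ext i j
  have := h1 i (Finset.mem_univ _)
  have this := (Finset.sum_eq_zero_iff_of_nonneg (f := fun j => (bp blk R i j) ^ 2)
    (fun j _ => sq_nonneg _)).mp this
  exact pow_eq_zero_iff (two_ne_zero) |>.mp (this j (Finset.mem_univ _))

/-- elimination of the polar part at infinity -/
lemma reduce (hα : Function.Injective α) (hA : A = Matrix.diagonal fun i => α (blk i))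
    {M : Matrix (Fin n) (Fin n) ℝ} (hM : ∀ i j, blk i = blk j → M i j = 0)
    (u : Fin n → ℝ) (hN : IsUnit (kry (nM blk α M) u).det)
    {R : Matrix (Fin n) (Fin n) ℝ} (hR : bp blk R = 0) (d : ℕ) :
    ∀ Y : (Matrix (Fin n) (Fin n) ℝ)[X], pen A M * Y - Y * pen A M = X ^ (d + 1) * C R →
      ∃ c ∈ CC A M, ∃ Y', Y - c = X ^ d * Y' ∧ pen A M * Y' - Y' * pen A M = X * C R := by
  induction d with
  | zero =>
    intro Y hY
    exact ⟨0, zero_mem _, Y, by simp, by simpa using hY⟩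
  | succ d ih =>
    intro Y hY
    have c0 := congrArg (fun Q => Q.coeff 0) hY
    have c1 := congrArg (fun Q => Q.coeff (0 + 1)) hY
    have c2 := congrArg (fun Q => Q.coeff (1 + 1)) hY
    simp only [pen_comm_coeff_zero] at c0
    simp only [pen_comm_coeff_succ] at c1 c2
    rw [coeff_X_pow_mul', if_neg (by omega)] at c0 c1
    have h0 : A * Y.coeff 0 = Y.coeff 0 * A := sub_eq_zero.mp c0
    have h2 : bp blk (M * Y.coeff 1 - Y.coeff 1 * M) = 0 := by
      have := congrArg (bp blk) c2
      rw [map_add, bp_adA hA, zero_add] at this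
      rw [this, coeff_X_pow_mul']
      split_ifs
      · rw [coeff_C]; split_ifs
        · exact hR
        · simp
      · simp
    have hcomm := nM_comm hα hA hM h0 c1 h2
    have hY0 := mem_adjoin_of_commute _ _ u hN hcomm
    obtain ⟨e, he, he0⟩ := mem_BB.mp
      (Algebra.adjoin_le (Set.singleton_subset_iff.mpr (nM_mem hα hA hM)) hY0)
    obtain ⟨Y2, hY2⟩ := exists_X_mul (P := Y - e) (by simp [he0])
    have hY2' : pen A M * Y2 - Y2 * pen A M = X ^ (d + 1) * C R := by
      have h3 : X * (pen A M * Y2 - Y2 * pen A M) = X * (X ^ (d + 1) * C R) := by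
        calc _ = pen A M * (X * Y2) - (X * Y2) * pen A M := by
              rw [mul_sub, ← mul_assoc, ← mul_assoc, ← mul_assoc, X_mul (p := pen A M)]
          _ = (pen A M * Y - Y * pen A M) - (pen A M * e - e * pen A M) := by
              rw [← hY2, mul_sub, sub_mul]; abel
          _ = _ := by rw [hY, CC_comm he, sub_zero, ← mul_assoc, ← pow_succ']
      ext1 i
      have := congrArg (fun Q => Q.coeff (i + 1)) h3
      simpa only [coeff_X_mul] using this
    obtain ⟨c, hc, Y', hY', hY''⟩ := ih Y2 hY2'
    refine ⟨e + X * c, add_mem he (mul_mem (X_mem A M) hc), Y', ?_, hY''⟩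
    rw [← sub_sub, hY2, ← mul_sub, hY', ← mul_assoc, ← pow_succ']

/-- completeness for cyclic `M` -/
lemma SS_of_cyclic (hα : Function.Injective α) (hA : A = Matrix.diagonal fun i => α (blk i))
    {M : Matrix (Fin n) (Fin n) ℝ} (hM : M ∈ vSet blk)
    (w : Fin n → ℝ[X])
    (hK : IsUnit (kry (M.map C + (X : ℝ[X]) • A.map C) w).det)
    (w' : Fin n → ℝ) (hK0 : IsUnit (kry M w').det)
    (u : Fin n → ℝ) (hN : IsUnit (kry (nM blk α M) u).det) : SS blk A M := by
  intro η hη htr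
  have hR := bp_j hα hA hM hη
  set R := M * η - η * M with hRdef
  set L : Matrix (Fin n) (Fin n) ℝ[X] := M.map C + (X : ℝ[X]) • A.map C with hL
  have hLev : ∀ lam : ℝ, L.map (eval lam) = M + lam • A := by
    intro lam; ext i j; simp [hL]; exact mul_comm _ _
  obtain ⟨Z', hZ'⟩ := exists_commutator L (R.map C) w hK (by
    intro j
    apply Polynomial.funext
    intro lam
    have h1 : ((evalRingHom lam).mapMatrix (R.map C * L ^ j)).trace = 0 := by
      rw [map_mul, map_pow]
      have e1 : (evalRingHom lam).mapMatrix L = M + lam • A := hLev lam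
      have e2 : (evalRingHom lam).mapMatrix (R.map C) = R := by ext i j; simp
      rw [e1, e2]; exact htr lam j
    rw [eval_zero, ← h1]
    simp [Matrix.trace, Polynomial.eval_finsetSum])
  set Z := matPolyEquiv Z' with hZ
  have hLm : matPolyEquiv L = C M + X * C A := by
    rw [hL, map_add, matPolyEquiv_map_smul, matPolyEquiv_map_C, matPolyEquiv_map_C]
    simp
  have hZeq : (C M + X * C A) * Z - Z * (C M + X * C A) = C R := by
    rw [← hLm, hZ, ← map_mul, ← map_mul, ← map_sub, hZ', matPolyEquiv_map_C]
  have z0 : M * Z.coeff 0 - Z.coeff 0 * M = R := by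
    have := pen_comm_coeff_zero M A Z
    rw [pen, hZeq] at this
    simpa using this.symm
  have zs : ∀ i, M * Z.coeff (i + 1) - Z.coeff (i + 1) * M + (A * Z.coeff i - Z.coeff i * A) = 0 := by
    intro i
    have := pen_comm_coeff_succ M A Z i
    rw [pen, hZeq, coeff_C_succ] at this
    exact this.symm
  set d := Z.natDegree with hd
  set Y := reflect d Z with hY
  have hYc : ∀ i, i ≤ d → Y.coeff i = Z.coeff (d - i) := by
    intro i hi; rw [hY, coeff_reflect, revAt_le hi]
  have hYc' : ∀ i, d < i → Y.coeff i = 0 := by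
    intro i hi
    rw [hY, coeff_reflect, revAt_eq_self_of_lt hi]
    exact coeff_eq_zero_of_natDegree_lt hi
  have hYeq : pen A M * Y - Y * pen A M = X ^ (d + 1) * C R := by
    ext1 i
    rcases i with _ | i
    · rw [pen_comm_coeff_zero, coeff_X_pow_mul', if_neg (by omega), hYc 0 (by omega)]
      have := zs d
      rw [coeff_eq_zero_of_natDegree_lt (n := d + 1) (by omega)] at this
      simpa using this
    · rw [pen_comm_coeff_succ, coeff_X_pow_mul']
      rcases lt_trichotomy i d with hi | hi | hi
      · rw [if_neg (by omega), hYc _ (by omega), hYc i (by omega)]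
        have := zs (d - (i + 1))
        rw [show d - (i + 1) + 1 = d - i by omega] at this
        rw [← this, add_comm]
      · rw [if_pos (by omega), hYc' (i + 1) (by omega), hYc i (by omega), hi]
        simp [z0]
      · rw [if_pos (by omega), hYc' (i + 1) (by omega), hYc' i hi, coeff_C, if_neg (by omega)]
        simp
  obtain ⟨c, hc, Y', hY', hY''⟩ := reduce hα hA hM.2 u hN hR d Y hYeq
  have hY0 : A * Y'.coeff 0 = Y'.coeff 0 * A := by
    have := pen_comm_coeff_zero A M Y'
    rw [hY''] at this
    simp at this
    exact sub_eq_zero.mp this.symm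
  have hq : Z.coeff 0 - η ∈ Algebra.adjoin ℝ {M} := by
    refine mem_adjoin_of_commute M _ w' hK0 ?_
    rw [← sub_eq_zero]
    calc _ = (M * Z.coeff 0 - Z.coeff 0 * M) - (M * η - η * M) := by noncomm_ring
      _ = 0 := by rw [z0, ← hRdef, sub_self]
  have hZ0 : Z.coeff 0 = c.coeff d + Y'.coeff 0 := by
    have := congrArg (fun Q => Q.coeff d) hY'
    simp only [coeff_sub] at this
    rw [hYc d le_rfl, Nat.sub_self, coeff_X_pow_mul', if_pos le_rfl, Nat.sub_self] at this
    rw [← this]; abel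
  have hη1 : η = c.coeff d + Y'.coeff 0 - (Z.coeff 0 - η) := by rw [hZ0]; abel
  rw [← qv_of_mem hη.1, hη1, map_sub, map_add, qv_of_comm hα hA hY0, add_zero]
  refine Submodule.sub_mem _ ?_ ?_
  · have := coeff_mem ((Submodule.span ℝ (restrictedManakovGradients blk A M)).comap (qv blk)) c ?_ d
    · exact this
    intro μ hμ
    rw [Submodule.mem_comap]
    refine qv_adjoin (lam := μ⁻¹) ?_
    refine Algebra.adjoin_le ?_ (mem_CC.mp hc μ hμ)
    rw [Set.singleton_subset_iff]
    have : A + μ • M = μ • (M + μ⁻¹ • A) := by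
      rw [smul_add, smul_smul, mul_inv_cancel₀ hμ, one_smul, add_comm]
    rw [this]
    exact Subalgebra.smul_mem _ (Algebra.self_mem_adjoin_singleton ℝ _) _
  · refine qv_adjoin (lam := 0) ?_
    simpa using hq

end
end RMC

namespace RMC
open Polynomial

/-- skew tridiagonal matrix -/
def tri (n : ℕ) (m : ℕ → ℝ) : Matrix (Fin n) (Fin n) ℝ :=
  Matrix.of fun i j => if (j : ℕ) = i + 1 then m i else if (i : ℕ) = j + 1 then - m j else 0

lemma tri_mem {n r : ℕ} {blk : Fin n → Fin r}
    (hb : ∀ i j : Fin n, (j : ℕ) = i + 1 → blk i ≠ blk j) (m : ℕ → ℝ) : tri n m ∈ vSet blk := by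
  constructor
  · ext i j
    simp only [tri, Matrix.transpose_apply, Matrix.of_apply, Matrix.neg_apply]
    split_ifs <;> first | omega | simp
  · intro i j hij
    simp only [tri, Matrix.of_apply]
    rw [if_neg (fun h => hb i j h hij), if_neg (fun h => hb j i h hij.symm)]

lemma exists_path {n r : ℕ} (blk : Fin n → Fin r) (α : Fin r → ℝ) (hα : Function.Injective α)
    (hb : ∀ i j : Fin n, (j : ℕ) = i + 1 → blk i ≠ blk j) :
    ∃ m : ℕ → ℝ, (∀ i, m i ≠ 0) ∧
      IsUnit (kry (nM blk α (tri n m)) (fun _ => 1)).det := by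
  set a : ℕ → ℝ := fun i => if h : i < n then α (blk ⟨i, h⟩) else 0 with ha
  have haf : ∀ i : Fin n, α (blk i) = a i := by intro i; simp [ha]
  have hab : ∀ i : ℕ, i + 1 < n → a (i + 1) - a i ≠ 0 := by
    intro i hi
    simp only [ha, dif_pos hi, dif_pos (show i < n by omega)]
    exact sub_ne_zero.mpr fun h => hb ⟨i, by omega⟩ ⟨i + 1, hi⟩ rfl (hα h).symm
  set c : ℕ → ℝ := fun i => if i + 1 < n then Real.sqrt ((i + 1) * |a (i + 1) - a i|) else 1 with hc
  have hc0 : ∀ i, c i ≠ 0 := by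
    intro i
    simp only [hc]
    split_ifs with h
    · refine (Real.sqrt_pos.mpr ?_).ne'
      have := abs_pos.mpr (hab i h)
      positivity
    · exact one_ne_zero
  have hcs : ∀ i, i + 1 < n → c i * c i = (i + 1) * |a (i + 1) - a i| := by
    intro i h
    simp only [hc, if_pos h]
    exact Real.mul_self_sqrt (by positivity)
  set m : ℝ → ℕ → ℝ := fun ε i => if Even i then c i else ε with hm
  set f : ℝ → ℝ := fun ε => (kry (nM blk α (tri n (m ε))) (fun _ => 1)).det with hf
  have hcont : Continuous f := by
    have h1 : Continuous fun ε => tri n (m ε) := by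
      refine continuous_matrix fun i j => ?_
      simp only [tri, Matrix.of_apply, hm]
      split_ifs <;> fun_prop
    have h2 : Continuous fun ε => gM blk α (tri n (m ε)) := by
      refine continuous_matrix fun i j => ?_
      simp only [gM, Matrix.of_apply]
      exact (h1.matrix_elem i j).div_const _
    have h3 : Continuous fun ε => nM blk α (tri n (m ε)) := by
      have h4 := h1.matrix_mul h2
      refine continuous_matrix fun i j => ?_
      simp only [nM, Matrix.neg_apply, bp_apply]
      split_ifs
      · exact (h4.matrix_elem i j).neg
      · fun_prop
    refine Continuous.matrix_det (continuous_matrix fun i j => ?_)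
    simp only [kry, Matrix.of_apply]
    exact (continuous_apply i).comp ((h3.pow _).matrix_mulVec continuous_const)
  have hf0 : f 0 ≠ 0 := by
    set M := tri n (m 0) with hM
    set θ : Fin n → ℝ := fun i => ∑ k, M i k * M i k / (a k - a i) with hθ
    have hskew : ∀ i j, M i j = - M j i := by
      intro i j
      have := congrFun (congrFun (tri_mem hb (m 0)).1 j) i
      simpa [hM] using this
    have hMz : ∀ i k j : Fin n, i ≠ j → M i k * M k j = 0 := by
      intro i k j hij
      have hij' : (i : ℕ) ≠ j := fun h => hij (Fin.ext h)
      simp only [hM, tri, Matrix.of_apply, hm]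
      by_cases e1 : Even (i : ℕ) <;> by_cases e2 : Even (k : ℕ) <;> by_cases e3 : Even (j : ℕ) <;>
      · simp only [e1, e2, e3, if_true, if_false]
        rw [Nat.even_iff] at e1 e2 e3
        split_ifs <;> first | omega | simp
    have hN : nM blk α M = Matrix.diagonal θ := by
      ext i j
      rw [nM, Matrix.neg_apply, bp_apply, Matrix.mul_apply]
      simp only [gM, Matrix.of_apply, haf]
      by_cases hij : i = j
      · subst hij
        rw [if_pos rfl, Matrix.diagonal_apply_eq, hθ]
        simp only
        rw [← Finset.sum_neg_distrib]
        refine Finset.sum_congr rfl fun k _ => ?_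
        rw [hskew k i]; ring
      · rw [Matrix.diagonal_apply_ne _ hij]
        split_ifs
        · rw [neg_eq_zero]
          refine Finset.sum_eq_zero fun k _ => ?_
          rw [← mul_div_assoc, hMz i k j hij, zero_div]
        · simp
    have hMsupp : ∀ i k : Fin n, Even (i : ℕ) → (k : ℕ) ≠ i + 1 → M i k = 0 := by
      intro i k he hk
      simp only [hM, tri, Matrix.of_apply, hm]
      rw [if_neg hk]
      split_ifs with h1 h2
      · rw [Nat.even_iff] at he h2; omega
      · simp
      · rfl
    have hMsupp' : ∀ i k : Fin n, ¬ Even (i : ℕ) → (i : ℕ) ≠ k + 1 → M i k = 0 := by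
      intro i k he hk
      simp only [hM, tri, Matrix.of_apply, hm]
      rw [if_neg hk, if_neg he]
      simp
    set s : ℕ → ℝ := fun i => |a (i + 1) - a i| / (a (i + 1) - a i) with hs
    have hss : ∀ i, i + 1 < n → s i * s i = 1 := by
      intro i h
      have := hab i h
      simp only [hs]
      rw [div_mul_div_comm, abs_mul_abs_self, div_self (mul_ne_zero this this)]
    have hθe : ∀ i : Fin n, Even (i : ℕ) → (i : ℕ) + 1 < n → θ i = s i * (i + 1) := by
      intro i he hi
      simp only [hθ]
      rw [Finset.sum_eq_single_of_mem (⟨i + 1, hi⟩ : Fin n) (Finset.mem_univ _)]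
      · have : M i ⟨i + 1, hi⟩ = c i := by simp [hM, tri, hm, he]
        rw [this, hcs i hi]; simp only [hs]; ring
      · intro k _ hk
        rw [hMsupp i k he (fun h => hk (Fin.ext h))]; simp
    have hθz : ∀ i : Fin n, Even (i : ℕ) → ¬ (i : ℕ) + 1 < n → θ i = 0 := by
      intro i he hi
      simp only [hθ]
      refine Finset.sum_eq_zero fun k _ => ?_
      rw [hMsupp i k he (by omega)]; simp
    have hθo : ∀ i : Fin n, ∀ t : ℕ, Even t → (i : ℕ) = t + 1 → θ i = - (s t * (t + 1)) := by
      intro i t he hi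
      have ho : ¬ Even (i : ℕ) := by rw [Nat.even_iff] at he ⊢; omega
      simp only [hθ]
      rw [Finset.sum_eq_single_of_mem (⟨t, by omega⟩ : Fin n) (Finset.mem_univ _)]
      · have : M i ⟨t, by omega⟩ = - c t := by
          simp only [hM, tri, hm, Matrix.of_apply]
          rw [if_neg (by omega), if_pos hi, if_pos he]
        rw [this, neg_mul_neg, hcs t (by omega), hi]; simp only [hs]
        rw [show a t - a (t + 1) = - (a (t + 1) - a t) by ring, div_neg]; ring
      · intro k _ hk
        rw [hMsupp' i k ho (fun h => hk (Fin.ext (by simp only; omega)))]; simp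
    have hsq : ∀ (t t' : ℕ) (x y : ℝ), x * x = 1 → y * y = 1 →
        x * (t + 1) = y * (t' + 1) → t = t' := by
      intro t t' x y hx hy h
      have h2 : ((t : ℝ) + 1) ^ 2 = ((t' : ℝ) + 1) ^ 2 := by
        calc ((t : ℝ) + 1) ^ 2 = (x * x) * ((t : ℝ) + 1) ^ 2 := by rw [hx, one_mul]
          _ = (x * (t + 1)) ^ 2 := by ring
          _ = (y * y) * ((t' : ℝ) + 1) ^ 2 := by rw [h]; ring
          _ = _ := by rw [hy, one_mul]
      have h3 := (pow_left_inj₀ (by positivity) (by positivity) two_ne_zero).mp h2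
      have h4 : (t : ℝ) = t' := by linarith
      exact_mod_cast h4
    have hnz : ∀ (t : ℕ) (x : ℝ), x * x = 1 → x * (t + 1) ≠ 0 := by
      intro t x hx
      have : x ≠ 0 := by rintro rfl; simp at hx
      have : (t : ℝ) + 1 ≠ 0 := by positivity
      positivity
    have hodd : ∀ i : Fin n, ¬ Even (i : ℕ) → ∃ t, Even t ∧ (i : ℕ) = t + 1 := by
      intro i hi
      refine ⟨i - 1, ?_, ?_⟩ <;> rw [Nat.even_iff] at * <;> omega
    have hinj : Function.Injective θ := by
      intro i j hij
      apply Fin.ext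
      by_cases ei : Even (i : ℕ) <;> by_cases ej : Even (j : ℕ)
      · by_cases hi : (i : ℕ) + 1 < n <;> by_cases hj : (j : ℕ) + 1 < n
        · rw [hθe i ei hi, hθe j ej hj] at hij
          exact hsq _ _ _ _ (hss _ hi) (hss _ hj) hij
        · rw [hθe i ei hi, hθz j ej hj] at hij
          exact absurd hij (hnz _ _ (hss _ hi))
        · rw [hθz i ei hi, hθe j ej hj] at hij
          exact absurd hij.symm (hnz _ _ (hss _ hj))
        · omega
      · obtain ⟨t, et, ht⟩ := hodd j ej
        rw [hθo j t et ht] at hij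
        by_cases hi : (i : ℕ) + 1 < n
        · rw [hθe i ei hi, ← neg_mul] at hij
          have := hsq _ _ _ _ (hss _ hi) (by rw [neg_mul_neg]; exact hss t (by omega)) hij
          subst this
          rw [neg_mul] at hij
          exact absurd (self_eq_neg.mp hij) (hnz _ _ (hss _ hi))
        · rw [hθz i ei hi] at hij
          exact absurd (neg_eq_zero.mp hij.symm) (hnz _ _ (hss t (by omega)))
      · obtain ⟨t, et, ht⟩ := hodd i ei
        rw [hθo i t et ht] at hij
        by_cases hj : (j : ℕ) + 1 < n
        · rw [hθe j ej hj, ← neg_mul] at hij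
          have := hsq _ _ _ _ (by rw [neg_mul_neg]; exact hss t (by omega)) (hss _ hj) hij
          subst this
          rw [neg_mul] at hij
          exact absurd (self_eq_neg.mp hij.symm) (hnz _ _ (hss _ hj))
        · rw [hθz j ej hj] at hij
          exact absurd (neg_eq_zero.mp hij) (hnz _ _ (hss t (by omega)))
      · obtain ⟨t, et, ht⟩ := hodd i ei
        obtain ⟨t', et', ht'⟩ := hodd j ej
        rw [hθo i t et ht, hθo j t' et' ht', neg_inj] at hij
        have := hsq _ _ _ _ (hss t (by omega)) (hss t' (by omega)) hij
        omega
    have hv : kry (nM blk α M) (fun _ => 1) = Matrix.vandermonde θ := by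
      rw [hN]
      ext i j
      rw [kry, Matrix.of_apply, Matrix.diagonal_pow, Matrix.mulVec_diagonal, Matrix.vandermonde_apply]
      simp
    rw [hf]
    simp only
    rw [hv]
    exact Matrix.det_vandermonde_ne_zero_iff.mpr hinj
  -- choose a small nonzero ε
  have hopen : ∀ᶠ ε in nhds (0 : ℝ), f ε ≠ 0 := hcont.continuousAt.eventually_ne hf0
  obtain ⟨ε, hε, hε0⟩ := ((hopen.filter_mono nhdsWithin_le_nhds).and
    (self_mem_nhdsWithin : {0}ᶜ ∈ nhdsWithin (0 : ℝ) {0}ᶜ)).exists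
  refine ⟨m ε, ?_, isUnit_iff_ne_zero.mpr hε⟩
  intro i
  simp only [hm]
  split_ifs
  · exact hc0 i
  · exact hε0

lemma SS_path {n r : ℕ} (blk : Fin n → Fin r) (α : Fin r → ℝ) (hα : Function.Injective α)
    (hb : ∀ i j : Fin n, (j : ℕ) = i + 1 → blk i ≠ blk j)
    (A : Matrix (Fin n) (Fin n) ℝ) (hA : A = Matrix.diagonal fun i => α (blk i)) :
    ∃ m : ℕ → ℝ, (∀ i, m i ≠ 0) ∧ SS blk A (tri n m) := by
  obtain ⟨m, hm0, hN⟩ := exists_path blk α hα hb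
  refine ⟨m, hm0, ?_⟩
  rcases Nat.eq_zero_or_pos n with rfl | hn
  · intro η _ _
    have : η = 0 := by ext i; exact i.elim0
    rw [this]; exact zero_mem _
  refine SS_of_cyclic hα hA (tri_mem hb m) (Pi.single ⟨0, hn⟩ 1) (kry_hessenberg hn _ ?_ ?_)
    (Pi.single ⟨0, hn⟩ 1) (kry_hessenberg hn _ ?_ ?_) _ hN
  · intro i j hij
    have : i ≠ j := by rintro rfl; omega
    simp only [Matrix.add_apply, Matrix.map_apply, Matrix.smul_apply, tri, Matrix.of_apply, hA,
      Matrix.diagonal_apply_ne _ this]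
    rw [if_neg (by omega), if_neg (by omega)]; simp
  · intro i j hij
    have : i ≠ j := by rintro rfl; omega
    simp only [Matrix.add_apply, Matrix.map_apply, Matrix.smul_apply, tri, Matrix.of_apply, hA,
      Matrix.diagonal_apply_ne _ this]
    rw [if_neg (by omega), if_pos hij]
    simp only [map_zero, smul_zero, add_zero]
    exact Polynomial.isUnit_C.mpr (isUnit_iff_ne_zero.mpr (neg_ne_zero.mpr (hm0 _)))
  · intro i j hij
    simp only [tri, Matrix.of_apply]
    rw [if_neg (by omega), if_neg (by omega)]
  · intro i j hij
    simp only [tri, Matrix.of_apply]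
    rw [if_neg (by omega), if_pos hij]
    exact isUnit_iff_ne_zero.mpr (neg_ne_zero.mpr (hm0 _))

end RMC

namespace RMC

/-- the 0/1 matrix of a map -/
def pm {n n' : ℕ} (σ : Fin n' → Fin n) : Matrix (Fin n) (Fin n') ℝ :=
  Matrix.of fun w i => if σ i = w then 1 else 0

section
variable {n n' r : ℕ} {σ : Fin n' → Fin n}

lemma pm_mul (Y : Matrix (Fin n') (Fin n') ℝ) (hσ : Function.Injective σ) (i j : Fin n') :
    (pm σ * Y * (pm σ)ᵀ) (σ i) (σ j) = Y i j := by
  simp [Matrix.mul_apply, pm, hσ.eq_iff]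

lemma pm_mul_left (Y : Matrix (Fin n') (Fin n') ℝ) {w : Fin n} (hw : w ∉ Set.range σ) (x : Fin n) :
    (pm σ * Y * (pm σ)ᵀ) w x = 0 := by
  have h : ∀ i, σ i ≠ w := fun i h => hw ⟨i, h⟩
  simp [Matrix.mul_apply, pm, h]

lemma pm_mul_right (Y : Matrix (Fin n') (Fin n') ℝ) {w : Fin n} (hw : w ∉ Set.range σ) (x : Fin n) :
    (pm σ * Y * (pm σ)ᵀ) x w = 0 := by
  have h : ∀ i, σ i ≠ w := fun i h => hw ⟨i, h⟩
  simp [Matrix.mul_apply, pm, h]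

lemma pm_tr (hσ : Function.Injective σ) : (pm σ)ᵀ * pm σ = 1 := by
  ext i j
  simp [Matrix.mul_apply, pm, Matrix.one_apply, hσ.eq_iff, eq_comm]

lemma pm_sub (η : Matrix (Fin n) (Fin n) ℝ) (i j : Fin n') :
    ((pm σ)ᵀ * η * pm σ) i j = η (σ i) (σ j) := by
  simp [Matrix.mul_apply, pm]

lemma ext_matrix {X Y : Matrix (Fin n) (Fin n) ℝ} (h1 : ∀ i j, X (σ i) (σ j) = Y (σ i) (σ j))
    (hX : ∀ w ∉ Set.range σ, ∀ x, X w x = 0 ∧ X x w = 0)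
    (hY : ∀ w ∉ Set.range σ, ∀ x, Y w x = 0 ∧ Y x w = 0) : X = Y := by
  ext w x
  by_cases hw : w ∈ Set.range σ
  · by_cases hx : x ∈ Set.range σ
    · obtain ⟨i, rfl⟩ := hw
      obtain ⟨j, rfl⟩ := hx
      exact h1 i j
    · rw [(hX x hx w).2, (hY x hx w).2]
  · rw [(hX w hw x).1, (hY w hw x).1]

lemma transfer {blk : Fin n → Fin r} {α : Fin r → ℝ} (hα : Function.Injective α)
    {A : Matrix (Fin n) (Fin n) ℝ} (hA : A = Matrix.diagonal fun i => α (blk i))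
    (hσ : Function.Injective σ) (A' M' : Matrix (Fin n') (Fin n') ℝ)
    (hA' : A' = Matrix.diagonal fun i => α (blk (σ i)))
    (hS : SS (fun i => blk (σ i)) A' M')
    (hv : ∀ η ∈ jSet blk A (pm σ * M' * (pm σ)ᵀ), ∀ w ∉ Set.range σ, ∀ x, η w x = 0) :
    SS blk A (pm σ * M' * (pm σ)ᵀ) := by
  intro η hη htr
  have hη0 := hv η hη
  set P := pm σ with hP
  set M0 := P * M' * Pᵀ with hM0
  have hPP : Pᵀ * P = 1 := pm_tr hσ
  have hAP : A * P = P * A' := by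
    rw [hA, hA']
    ext w i
    rw [Matrix.diagonal_mul, Matrix.mul_diagonal, hP]
    simp only [pm, Matrix.of_apply]
    split_ifs with h
    · rw [h]; ring
    · simp
  have hPA : Pᵀ * A = A' * Pᵀ := by
    have := congrArg Matrix.transpose hAP
    rw [Matrix.transpose_mul, Matrix.transpose_mul, hA, hA', Matrix.diagonal_transpose,
      Matrix.diagonal_transpose] at this
    rw [hA, hA', this]
  have hηsk : ∀ i j, η i j = - η j i := fun i j => by
    have := congrFun (congrFun hη.1.1 j) i
    simpa using this
  set η' := Pᵀ * η * P with hη'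
  have hηe : η = P * η' * Pᵀ := by
    refine ext_matrix (σ := σ) (fun i j => ?_) (fun w hw x => ⟨hη0 w hw x, ?_⟩)
      (fun w hw x => ⟨pm_mul_left _ hw x, pm_mul_right _ hw x⟩)
    · rw [pm_mul _ hσ, hη', pm_sub]
    · rw [hηsk, hη0 w hw x, neg_zero]
  set R' := M' * η' - η' * M' with hR'
  have hR : M0 * η - η * M0 = P * R' * Pᵀ := by
    have e1 : M0 * η = P * (M' * η') * Pᵀ := by
      calc M0 * η = P * M' * (Pᵀ * P) * η' * Pᵀ := by
            rw [hηe, hM0]; simp only [Matrix.mul_assoc]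
        _ = _ := by rw [hPP, Matrix.mul_one]; simp only [Matrix.mul_assoc]
    have e2 : η * M0 = P * (η' * M') * Pᵀ := by
      calc η * M0 = P * η' * (Pᵀ * P) * M' * Pᵀ := by
            conv_lhs => rw [hηe, hM0]
            simp only [Matrix.mul_assoc]
        _ = _ := by rw [hPP, Matrix.mul_one]; simp only [Matrix.mul_assoc]
    rw [e1, e2, hR', Matrix.mul_sub, Matrix.sub_mul]
  have hLP : ∀ (lam : ℝ) (j : ℕ), (M0 + lam • A) ^ j * P = P * (M' + lam • A') ^ j := by
    intro lam j
    induction j with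
    | zero => simp
    | succ j ih =>
      have : (M0 + lam • A) * P = P * (M' + lam • A') := by
        rw [Matrix.add_mul, Matrix.mul_add, Matrix.smul_mul, Matrix.mul_smul, hAP, hM0,
          Matrix.mul_assoc, hPP, Matrix.mul_one]
      rw [pow_succ, Matrix.mul_assoc, this, ← Matrix.mul_assoc, ih, Matrix.mul_assoc, ← pow_succ]
  have hη'j : η' ∈ jSet (fun i => blk (σ i)) A' M' := by
    refine ⟨⟨?_, ?_⟩, ?_⟩
    · rw [hη', Matrix.transpose_mul, Matrix.transpose_mul, hη.1.1, Matrix.transpose_transpose]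
      simp [Matrix.mul_assoc]
    · intro i j hij
      rw [hη', pm_sub]
      exact hη.1.2 _ _ hij
    · intro X hX hXA
      have h1 := hη.2 (P * X * Pᵀ) ?_ ?_
      · rw [hR] at h1
        rw [← h1]
        calc (R' * X).trace = (Pᵀ * P * R' * (Pᵀ * P) * X).trace := by
              rw [hPP, Matrix.mul_one, Matrix.one_mul]
          _ = (P * R' * Pᵀ * (P * X * Pᵀ)).trace := by
            rw [show Pᵀ * P * R' * (Pᵀ * P) * X = Pᵀ * (P * R' * Pᵀ * (P * X)) by
              simp only [Matrix.mul_assoc], Matrix.trace_mul_comm]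
            simp only [Matrix.mul_assoc]
      · rw [Matrix.transpose_mul, Matrix.transpose_mul, hX, Matrix.transpose_transpose]
        simp [Matrix.mul_assoc]
      · rw [Matrix.mul_assoc, hPA, Matrix.mul_assoc, ← Matrix.mul_assoc X, hXA,
          ← Matrix.mul_assoc, ← Matrix.mul_assoc, ← Matrix.mul_assoc, ← hAP, Matrix.mul_assoc A,
          Matrix.mul_assoc A]
  have hη's := hS η' hη'j (by
    intro lam j
    rw [← htr lam j, hR, ← hR']
    calc (R' * (M' + lam • A') ^ j).trace = (R' * (Pᵀ * (P * (M' + lam • A') ^ j))).trace := by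
          rw [← Matrix.mul_assoc Pᵀ, hPP, Matrix.one_mul]
      _ = (R' * Pᵀ * (M0 + lam • A) ^ j * P).trace := by
          rw [← hLP]; simp only [Matrix.mul_assoc]
      _ = _ := by rw [Matrix.trace_mul_comm]; simp only [Matrix.mul_assoc])
  -- push forward of the span
  let Φ : Matrix (Fin n') (Fin n') ℝ →ₗ[ℝ] Matrix (Fin n) (Fin n) ℝ :=
    { toFun := fun Y => P * Y * Pᵀ
      map_add' := fun X Y => by rw [Matrix.mul_add, Matrix.add_mul]
      map_smul' := fun c X => by simp }
  have hΦ : ∀ Y, Φ (qv (fun i => blk (σ i)) Y) = qv blk (P * Y * Pᵀ) := by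
    intro Y
    refine ext_matrix (σ := σ) (fun i j => ?_) (fun w hw x => ⟨pm_mul_left _ hw x, pm_mul_right _ hw x⟩)
      (fun w hw x => ?_)
    · change (P * (qv (fun i => blk (σ i)) Y) * Pᵀ) _ _ = _
      rw [pm_mul _ hσ, qv_apply, qv_apply, pm_mul _ hσ, pm_mul _ hσ]
    · rw [qv_apply, qv_apply, pm_mul_left _ hw, pm_mul_right _ hw]; simp
  set E : Matrix (Fin n) (Fin n) ℝ := 1 - P * Pᵀ with hE
  have hEA : A * E = E * A := by
    rw [hE, Matrix.mul_sub, Matrix.sub_mul, ← Matrix.mul_assoc, hAP, Matrix.mul_assoc P Pᵀ, hPA]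
    simp [Matrix.mul_assoc]
  have hM0E : M0 * E = 0 := by
    rw [hM0, hE, Matrix.mul_sub, Matrix.mul_one,
      show P * M' * Pᵀ * (P * Pᵀ) = P * M' * (Pᵀ * P) * Pᵀ by simp only [Matrix.mul_assoc], hPP,
      Matrix.mul_one, sub_self]
  have hLE : ∀ (lam : ℝ) (j : ℕ), (M0 + lam • A) ^ j * E = lam ^ j • (A ^ j * E) := by
    intro lam j
    induction j with
    | zero => simp
    | succ j ih =>
      rw [pow_succ, Matrix.mul_assoc, Matrix.add_mul, hM0E, zero_add, Matrix.smul_mul, hEA,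
        Matrix.mul_smul, ← Matrix.mul_assoc, ih, Matrix.smul_mul, smul_smul, Matrix.mul_assoc,
        ← hEA, ← Matrix.mul_assoc, ← pow_succ, ← pow_succ']
  have hgr : Submodule.span ℝ (restrictedManakovGradients (fun i => blk (σ i)) A' M') ≤
      (Submodule.span ℝ (restrictedManakovGradients blk A M0)).comap Φ := by
    rw [Submodule.span_le]
    rintro _ ⟨lam, j, rfl⟩
    refine Submodule.subset_span ⟨lam, j, ?_⟩
    change Φ (qv (fun i => blk (σ i)) _) = qv blk _
    rw [hΦ, ← hLP, Matrix.mul_assoc]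
    have h1 : (M0 + lam • A) ^ j = (M0 + lam • A) ^ j * (P * Pᵀ) + (M0 + lam • A) ^ j * E := by
      rw [hE, ← Matrix.mul_add]; simp
    conv_rhs => rw [h1, map_add, hLE, map_smul]
    have : qv blk (A ^ j * E) = 0 := by
      refine qv_of_comm hα hA ?_
      rw [← Matrix.mul_assoc, ← pow_succ', pow_succ, Matrix.mul_assoc, hEA, Matrix.mul_assoc]
    rw [this]; simp
  have := hgr hη's
  rw [Submodule.mem_comap] at this
  rw [hηe]
  exact this

lemma pm_mem {blk : Fin n → Fin r} (hσ : Function.Injective σ) {M' : Matrix (Fin n') (Fin n') ℝ}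
    (hM : M' ∈ vSet (fun i => blk (σ i))) : pm σ * M' * (pm σ)ᵀ ∈ vSet blk := by
  constructor
  · rw [Matrix.transpose_mul, Matrix.transpose_mul, hM.1, Matrix.transpose_transpose]
    simp [Matrix.mul_assoc]
  · intro w x hwx
    by_cases hw : w ∈ Set.range σ
    · by_cases hx : x ∈ Set.range σ
      · obtain ⟨i, rfl⟩ := hw
        obtain ⟨j, rfl⟩ := hx
        rw [pm_mul _ hσ]
        exact hM.2 i j hwx
      · exact pm_mul_right _ hx w
    · exact pm_mul_left _ hw x

lemma vanish {blk : Fin n → Fin r} {α : Fin r → ℝ} (hα : Function.Injective α)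
    {A : Matrix (Fin n) (Fin n) ℝ} (hA : A = Matrix.diagonal fun i => α (blk i))
    (hσ : Function.Injective σ) (he : Even n') (m : ℕ → ℝ) (hm : ∀ i, m i ≠ 0)
    (hM : tri n' m ∈ vSet (fun i => blk (σ i))) (p : Fin r)
    (hp : ∀ i : Fin n', Even (i : ℕ) → blk (σ i) = p)
    (hw : ∀ w ∉ Set.range σ, blk w = p)
    (η : Matrix (Fin n) (Fin n) ℝ) (hη : η ∈ jSet blk A (pm σ * tri n' m * (pm σ)ᵀ)) :
    ∀ w ∉ Set.range σ, ∀ x, η w x = 0 := by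
  intro w hwr
  have hb := bp_j hα hA (pm_mem hσ hM) hη
  have key : ∀ a : Fin n', Even (a : ℕ) → ∑ b, tri n' m a b * η (σ b) w = 0 := by
    intro a ha
    have h1 := congrFun (congrFun hb (σ a)) w
    rw [bp_apply, if_pos (by rw [hp a ha, hw w hwr]), Matrix.sub_apply] at h1
    have h2 : (η * (pm σ * tri n' m * (pm σ)ᵀ)) (σ a) w = 0 := by
      rw [Matrix.mul_apply]
      refine Finset.sum_eq_zero fun k _ => ?_
      rw [pm_mul_right _ hwr, mul_zero]
    rw [h2, sub_zero, Matrix.mul_apply] at h1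
    rw [Matrix.zero_apply] at h1
    rw [← h1]
    refine Fintype.sum_of_injective σ hσ _ _ (fun i hi => ?_) (fun i => ?_)
    · rw [pm_mul_right _ hi, zero_mul]
    · rw [pm_mul _ hσ]
  have hodd : ∀ t : ℕ, ∀ b : Fin n', (b : ℕ) = 2 * t + 1 → η (σ b) w = 0 := by
    intro t
    induction t with
    | zero =>
      intro b hb
      have := key ⟨0, by omega⟩ (by simp)
      rw [Finset.sum_eq_single_of_mem b (Finset.mem_univ _)] at this
      · rcases mul_eq_zero.mp this with h | h
        · simp [tri, hb] at h; exact absurd h (hm _)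
        · exact h
      · intro c _ hc
        have : (c : ℕ) ≠ 1 := fun h => hc (Fin.ext (by omega))
        simp [tri, this]
    | succ t ih =>
      intro b hb
      have := key ⟨2 * t + 2, by omega⟩ ⟨t + 1, by simp only; omega⟩
      rw [Finset.sum_eq_single_of_mem b (Finset.mem_univ _)] at this
      · rcases mul_eq_zero.mp this with h | h
        · simp only [tri, Matrix.of_apply] at h
          rw [if_pos (by omega)] at h; exact absurd h (hm _)
        · exact h
      · intro c _ hc
        by_cases h1 : (c : ℕ) = 2 * t + 1
        · rw [ih c h1, mul_zero]
        · have : (c : ℕ) ≠ b := fun h => hc (Fin.ext h)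
          simp only [tri, Matrix.of_apply]
          rw [if_neg (by omega), if_neg (by omega), zero_mul]
  intro x
  have hsk : η w x = - η x w := by
    have := congrFun (congrFun hη.1.1 x) w
    simpa using this
  by_cases hx : x ∈ Set.range σ
  · obtain ⟨b, rfl⟩ := hx
    rcases Nat.even_or_odd' (b : ℕ) with ⟨t, ht | ht⟩
    · exact hη.1.2 _ _ (by rw [hw w hwr, hp b ⟨t, by omega⟩])
    · rw [hsk, hodd t b ht, neg_zero]
  · exact hη.1.2 _ _ (by rw [hw w hwr, hw x hx])

end
end RMC

namespace RMC

lemma exists_SS {n r : ℕ} (blk : Fin n → Fin r) (hmono : Monotone blk)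
    (α : Fin r → ℝ) (hα : Function.Injective α)
    (A : Matrix (Fin n) (Fin n) ℝ) (hA : A = Matrix.diagonal fun i => α (blk i)) :
    ∃ M ∈ vSet blk, SS blk A M := by
  classical
  set h := (n + 1) / 2 with hh
  by_cases hc : ∀ p, (Finset.univ.filter fun i => blk i = p).card < h
  · -- interleaving
    have hdist : ∀ i j : Fin n, (i : ℕ) + h ≤ j + 1 → blk i ≠ blk j := by
      intro i j hij hb
      rcases Nat.eq_zero_or_pos h with h0 | h0
      · have := hc (blk i); omega
      have h1 : Finset.Icc i j ⊆ Finset.univ.filter fun t => blk t = blk i := by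
        intro t ht
        rw [Finset.mem_Icc] at ht
        simp only [Finset.mem_filter, Finset.mem_univ, true_and]
        exact le_antisymm (hb ▸ hmono ht.2) (hmono ht.1)
      have h2 := Finset.card_le_card h1
      rw [Fin.card_Icc] at h2
      have := hc (blk i)
      omega
    let σ : Fin n → Fin n := fun i =>
      if (i : ℕ) % 2 = 0 then ⟨i / 2, by omega⟩ else ⟨(h + i / 2) % n, Nat.mod_lt _ i.pos⟩
    have hσe : ∀ i : Fin n, (i : ℕ) % 2 = 0 → (σ i : ℕ) = i / 2 := by
      intro i hi; simp only [σ, if_pos hi]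
    have hσo : ∀ i : Fin n, (i : ℕ) % 2 ≠ 0 → (σ i : ℕ) = h + i / 2 := by
      intro i hi
      simp only [σ, if_neg hi]
      exact Nat.mod_eq_of_lt (by omega)
    have hσ : Function.Injective σ := by
      intro i j hij
      have hij := congrArg Fin.val hij
      apply Fin.ext
      by_cases hi : (i : ℕ) % 2 = 0 <;> by_cases hj : (j : ℕ) % 2 = 0
      · rw [hσe i hi, hσe j hj] at hij; omega
      · rw [hσe i hi, hσo j hj] at hij; omega
      · rw [hσo i hi, hσe j hj] at hij; omega
      · rw [hσo i hi, hσo j hj] at hij; omega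
    have hb : ∀ i j : Fin n, (j : ℕ) = i + 1 → blk (σ i) ≠ blk (σ j) := by
      intro i j hij
      by_cases hi : (i : ℕ) % 2 = 0
      · refine hdist _ _ ?_
        rw [hσe i hi, hσo j (by omega)]; omega
      · refine (hdist _ _ ?_).symm
        rw [hσo i hi, hσe j (by omega)]; omega
    obtain ⟨m, hm0, hS⟩ := SS_path (fun i => blk (σ i)) α hα hb _ rfl
    refine ⟨_, pm_mem hσ (tri_mem hb m), transfer hα hA hσ _ _ rfl hS ?_⟩
    intro η _ w hw
    exact absurd (Finite.injective_iff_surjective.mp hσ w) hw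
  · -- one large block
    push Not at hc
    obtain ⟨p, hp⟩ := hc
    set s := Finset.univ.filter fun i => blk i = p with hs
    set d := sᶜ.card with hd
    have hsd : d + s.card = n := by
      rw [hd, Finset.card_compl_add_card, Fintype.card_fin]
    let e1 := s.orderEmbOfFin rfl
    let e2 := sᶜ.orderEmbOfFin rfl
    let σ : Fin (2 * d) → Fin n := fun i =>
      if (i : ℕ) % 2 = 0 then e1 ⟨i / 2, by omega⟩ else e2 ⟨i / 2, by omega⟩
    have he1 : ∀ x, blk (e1 x) = p := by
      intro x
      have : e1 x ∈ s := s.orderEmbOfFin_mem rfl x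
      exact (Finset.mem_filter.mp this).2
    have he2 : ∀ x, blk (e2 x) ≠ p := by
      intro x
      have : e2 x ∈ sᶜ := sᶜ.orderEmbOfFin_mem rfl x
      intro h
      exact (Finset.mem_compl.mp this) (Finset.mem_filter.mpr ⟨Finset.mem_univ _, h⟩)
    have hσe : ∀ i : Fin (2 * d), (i : ℕ) % 2 = 0 → blk (σ i) = p := by
      intro i hi; simp only [σ, if_pos hi]; exact he1 _
    have hσo : ∀ i : Fin (2 * d), (i : ℕ) % 2 ≠ 0 → blk (σ i) ≠ p := by
      intro i hi; simp only [σ, if_neg hi]; exact he2 _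
    have hσ : Function.Injective σ := by
      intro i j hij
      by_cases hi : (i : ℕ) % 2 = 0 <;> by_cases hj : (j : ℕ) % 2 = 0
      · simp only [σ, if_pos hi, if_pos hj] at hij
        have := congrArg Fin.val (e1.injective hij)
        apply Fin.ext
        simp only at this; omega
      · exact absurd (hij ▸ hσe i hi) (hσo j hj)
      · exact absurd (hij ▸ hσe j hj) (hσo i hi)
      · simp only [σ, if_neg hi, if_neg hj] at hij
        have := congrArg Fin.val (e2.injective hij)
        apply Fin.ext
        simp only at this; omega
    have hb : ∀ i j : Fin (2 * d), (j : ℕ) = i + 1 → blk (σ i) ≠ blk (σ j) := by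
      intro i j hij
      by_cases hi : (i : ℕ) % 2 = 0
      · rw [hσe i hi]; exact (hσo j (by omega)).symm
      · rw [hσe j (by omega)]; exact hσo i hi
    have hw : ∀ w ∉ Set.range σ, blk w = p := by
      intro w hw
      by_contra hwp
      have hws : w ∈ sᶜ := by simpa [hs] using hwp
      have hr : w ∈ Set.range e2 := by
        rw [Finset.range_orderEmbOfFin]; exact hws
      obtain ⟨x, rfl⟩ := hr
      refine hw ⟨⟨2 * x + 1, by have := x.2; omega⟩, ?_⟩
      simp only [σ]
      rw [if_neg (by omega)]
      congr 1
      apply Fin.ext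
      simp only; omega
    obtain ⟨m, hm0, hS⟩ := SS_path (fun i => blk (σ i)) α hα hb _ rfl
    refine ⟨_, pm_mem hσ (tri_mem hb m), transfer hα hA hσ _ _ rfl hS ?_⟩
    exact vanish hα hA hσ ⟨d, by omega⟩ m hm0 (tri_mem hb m) p
      (fun i hi => hσe i (Nat.even_iff.mp hi)) hw

end RMC

namespace RMC

section
variable {n r : ℕ} {blk : Fin n → Fin r} {α : Fin r → ℝ} {A : Matrix (Fin n) (Fin n) ℝ}

lemma tr_qv {X : Matrix (Fin n) (Fin n) ℝ} (hX : X ∈ vSet blk) (Y : Matrix (Fin n) (Fin n) ℝ) :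
    (qv blk Y * X).trace = (Y * X).trace := by
  have hsk : ∀ i j, X i j = - X j i := fun i j => by
    have := congrFun (congrFun hX.1 j) i
    simpa using this
  simp only [Matrix.trace, Matrix.diag, Matrix.mul_apply]
  have h1 : ∀ i j, qv blk Y i j * X j i = (Y i j * X j i + Y j i * X i j) / 2 := by
    intro i j
    rw [qv_apply]
    split_ifs with h
    · rw [hX.2 i j h, hX.2 j i h.symm]; ring
    · rw [hsk i j]; ring
  simp only [h1]
  have h2 : ∑ i, ∑ j, Y j i * X i j = ∑ i, ∑ j, Y i j * X j i := Finset.sum_comm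
  simp only [add_div, Finset.sum_add_distrib]
  simp only [← Finset.sum_div]
  rw [h2]; ring

lemma mem_v_of_bp {X : Matrix (Fin n) (Fin n) ℝ} (h1 : Xᵀ = -X) (h2 : bp blk X = 0) :
    X ∈ vSet blk := by
  refine ⟨h1, fun i j hij => ?_⟩
  have := congrFun (congrFun h2 i) j
  rwa [bp_apply, if_pos hij] at this

lemma tr_cyc (M q X : Matrix (Fin n) (Fin n) ℝ) :
    ((M * q - q * M) * X).trace = (q * (X * M - M * X)).trace := by
  rw [Matrix.sub_mul, Matrix.mul_sub, Matrix.trace_sub, Matrix.trace_sub,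
    Matrix.mul_assoc M, Matrix.trace_mul_comm M, Matrix.mul_assoc, Matrix.mul_assoc]

lemma gen_mem_j (hα : Function.Injective α) (hA : A = Matrix.diagonal fun i => α (blk i))
    {M : Matrix (Fin n) (Fin n) ℝ} (hM : M ∈ vSet blk) (lam : ℝ) (j : ℕ) :
    qv blk ((M + lam • A) ^ j) ∈ jSet blk A M := by
  refine ⟨qv_mem _, fun X hX hXA => ?_⟩
  have hv : X * M - M * X ∈ vSet blk := by
    refine mem_v_of_bp (skew_comm hX hM.1) ?_
    rw [map_sub, bp_mul_left hα hA hXA.symm, bp_mul_right hα hA hXA.symm, bp_M hM.2]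
    simp
  rw [tr_cyc, tr_qv hv]
  have : X * M - M * X = X * (M + lam • A) - (M + lam • A) * X := by
    rw [Matrix.mul_add, Matrix.add_mul, Matrix.mul_smul, Matrix.smul_mul, hXA]; abel
  rw [this, Matrix.mul_sub, ← Matrix.mul_assoc, ← Matrix.mul_assoc, Matrix.trace_sub, ← pow_succ,
    Matrix.trace_mul_comm, ← Matrix.mul_assoc, ← pow_succ', Matrix.trace_mul_comm, sub_self]

/-- `j_M` as a submodule -/
def jSub (blk : Fin n → Fin r) (A M : Matrix (Fin n) (Fin n) ℝ) :
    Submodule ℝ (Matrix (Fin n) (Fin n) ℝ) where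
  carrier := jSet blk A M
  zero_mem' := ⟨⟨by simp, by simp⟩, by simp⟩
  add_mem' := by
    rintro x y ⟨⟨hx1, hx2⟩, hx3⟩ ⟨⟨hy1, hy2⟩, hy3⟩
    refine ⟨⟨?_, ?_⟩, ?_⟩
    · rw [Matrix.transpose_add, hx1, hy1]; abel
    · intro i j h; rw [Matrix.add_apply, hx2 i j h, hy2 i j h, add_zero]
    · intro X h1 h2
      rw [show M * (x + y) - (x + y) * M = (M * x - x * M) + (M * y - y * M) by noncomm_ring,
        Matrix.add_mul, Matrix.trace_add, hx3 X h1 h2, hy3 X h1 h2, add_zero]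
  smul_mem' := by
    rintro c x ⟨⟨hx1, hx2⟩, hx3⟩
    refine ⟨⟨?_, ?_⟩, ?_⟩
    · rw [Matrix.transpose_smul, hx1, smul_neg]
    · intro i j h; rw [Matrix.smul_apply, hx2 i j h, smul_zero]
    · intro X h1 h2
      rw [Matrix.mul_smul, Matrix.smul_mul, ← smul_sub, Matrix.smul_mul, Matrix.trace_smul,
        hx3 X h1 h2, smul_zero]

lemma F_le_j (hα : Function.Injective α) (hA : A = Matrix.diagonal fun i => α (blk i))
    {M : Matrix (Fin n) (Fin n) ℝ} (hM : M ∈ vSet blk) :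
    Submodule.span ℝ (restrictedManakovGradients blk A M) ≤ jSub blk A M := by
  rw [Submodule.span_le]
  rintro _ ⟨lam, j, rfl⟩
  exact gen_mem_j hα hA hM lam j

lemma tr_rel (hα : Function.Injective α) (hA : A = Matrix.diagonal fun i => α (blk i))
    {M η : Matrix (Fin n) (Fin n) ℝ} (hM : M ∈ vSet blk) (hη : η ∈ jSet blk A M)
    (Y : Matrix (Fin n) (Fin n) ℝ) :
    (M * (qv blk Y * η - η * qv blk Y)).trace = - ((M * η - η * M) * Y).trace := by
  have hv : M * η - η * M ∈ vSet blk := mem_v_of_bp (skew_comm hM.1 hη.1.1) (bp_j hα hA hM hη)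
  rw [Matrix.trace_mul_comm _ Y, ← tr_qv hv]
  generalize qv blk Y = q
  have e1 : (M * (q * η)).trace = (q * (η * M)).trace := by
    rw [Matrix.trace_mul_comm, Matrix.mul_assoc]
  have e2 : (M * (η * q)).trace = (q * (M * η)).trace := by
    rw [← Matrix.mul_assoc, Matrix.trace_mul_comm]
  rw [Matrix.mul_sub, Matrix.mul_sub, Matrix.trace_sub, Matrix.trace_sub, e1, e2]
  ring

lemma iso1 (M : Matrix (Fin n) (Fin n) ℝ) (lam mu : ℝ) (j k : ℕ) :
    ((M * (M + mu • A) ^ k - (M + mu • A) ^ k * M) * (M + lam • A) ^ j).trace = 0 := by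
  set Q := (M + mu • A) ^ k with hQ
  set P := (M + lam • A) ^ j with hP
  have hQc : (M + mu • A) * Q = Q * (M + mu • A) := by rw [hQ, ← pow_succ, pow_succ']
  have hPc : (M + lam • A) * P = P * (M + lam • A) := by rw [hP, ← pow_succ, pow_succ']
  have e1 : ((M * Q - Q * M) * P).trace + mu * ((A * Q - Q * A) * P).trace = 0 := by
    have e0 : mu * ((A * Q - Q * A) * P).trace = ((mu • (A * Q - Q * A)) * P).trace := by
      rw [Matrix.smul_mul, Matrix.trace_smul, smul_eq_mul]
    have : (M * Q - Q * M) + mu • (A * Q - Q * A) = 0 := by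
      rw [← sub_eq_zero.mpr hQc, Matrix.add_mul, Matrix.mul_add, Matrix.smul_mul, Matrix.mul_smul,
        smul_sub]
      abel
    rw [e0, ← Matrix.trace_add, ← Matrix.add_mul,
      this]
    simp
  have e2 : ((M * Q - Q * M) * P).trace + lam * ((A * Q - Q * A) * P).trace = 0 := by
    have e0 : lam * ((A * Q - Q * A) * P).trace = ((lam • (A * Q - Q * A)) * P).trace := by
      rw [Matrix.smul_mul, Matrix.trace_smul, smul_eq_mul]
    have : (M * Q - Q * M) + lam • (A * Q - Q * A) = (M + lam • A) * Q - Q * (M + lam • A) := by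
      rw [Matrix.add_mul, Matrix.mul_add, Matrix.smul_mul, Matrix.mul_smul, smul_sub]
      abel
    rw [e0, ← Matrix.trace_add, ← Matrix.add_mul,
      this, tr_cyc, hPc]
    simp
  by_cases h : lam = mu
  · subst h
    have hPQ : P * Q = Q * P := by rw [hP, hQ, ← pow_add, ← pow_add, Nat.add_comm]
    rw [Matrix.sub_mul, Matrix.trace_sub, Matrix.mul_assoc, Matrix.mul_assoc, ← hPQ,
      Matrix.trace_mul_comm Q, Matrix.mul_assoc, sub_self]
  · have h3 : (lam - mu) * ((A * Q - Q * A) * P).trace = 0 := by linarith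
    rcases mul_eq_zero.mp h3 with h4 | h4
    · exact absurd (sub_eq_zero.mp h4) h
    · rw [h4] at e1; simpa using e1

lemma iso2 (hα : Function.Injective α) (hA : A = Matrix.diagonal fun i => α (blk i))
    {M : Matrix (Fin n) (Fin n) ℝ} (hM : M ∈ vSet blk) (lam mu : ℝ) (j k : ℕ) :
    ((M * qv blk ((M + mu • A) ^ k) - qv blk ((M + mu • A) ^ k) * M) * (M + lam • A) ^ j).trace = 0 := by
  let φ : Matrix (Fin n) (Fin n) ℝ →ₗ[ℝ] ℝ :=
    { toFun := fun Y => ((M * Y - Y * M) * (M + lam • A) ^ j).trace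
      map_add' := fun x y => by
        rw [show M * (x + y) - (x + y) * M = (M * x - x * M) + (M * y - y * M) by noncomm_ring,
          Matrix.add_mul, Matrix.trace_add]
      map_smul' := fun c x => by
        rw [Matrix.mul_smul, Matrix.smul_mul, ← smul_sub, Matrix.smul_mul, Matrix.trace_smul]; rfl }
  set Q := (M + mu • A) ^ k with hQ
  change φ (qv blk Q) = 0
  have h1 : qv blk Q = (1 / 2 : ℝ) • (Q - Qᵀ) - bp blk ((1 / 2 : ℝ) • (Q - Qᵀ)) := by
    ext a b
    rw [qv_apply, Matrix.sub_apply, bp_apply]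
    split_ifs
    · simp
    · simp; ring
  have hD : ∀ D, A * D = D * A → φ D = 0 := by
    intro D hD
    change ((M * D - D * M) * (M + lam • A) ^ j).trace = 0
    have : M * D - D * M = (M + lam • A) * D - D * (M + lam • A) := by
      rw [Matrix.mul_add, Matrix.add_mul, Matrix.mul_smul, Matrix.smul_mul, hD]; abel
    rw [this, tr_cyc, ← pow_succ, ← pow_succ']
    simp
  have hQt : Qᵀ = (-1 : ℝ) ^ k • (M + (-mu) • A) ^ k := by
    rw [hQ, Matrix.transpose_pow, Matrix.transpose_add, Matrix.transpose_smul, hM.1, hA,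
      Matrix.diagonal_transpose, ← hA, ← smul_pow]
    congr 1
    rw [smul_add, smul_smul]; simp
  rw [h1, map_sub, hD _ (bp_comm hα hA _), map_smul, map_sub, hQt, map_smul]
  have e1 : φ Q = 0 := iso1 M lam mu j k
  have e2 : φ ((M + (-mu) • A) ^ k) = 0 := iso1 M lam (-mu) j k
  rw [e1, e2]; simp

lemma iso3 (hα : Function.Injective α) (hA : A = Matrix.diagonal fun i => α (blk i))
    {M : Matrix (Fin n) (Fin n) ℝ} (hM : M ∈ vSet blk)
    {η : Matrix (Fin n) (Fin n) ℝ}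
    (hη : η ∈ Submodule.span ℝ (restrictedManakovGradients blk A M)) (lam : ℝ) (j : ℕ) :
    ((M * η - η * M) * (M + lam • A) ^ j).trace = 0 := by
  induction hη using Submodule.span_induction with
  | mem x hx =>
    obtain ⟨mu, k, rfl⟩ := hx
    exact iso2 hα hA hM lam mu j k
  | zero => simp
  | add x y _ _ hx hy =>
    rw [show M * (x + y) - (x + y) * M = (M * x - x * M) + (M * y - y * M) by noncomm_ring,
      Matrix.add_mul, Matrix.trace_add, hx, hy, add_zero]
  | smul c x _ hx =>
    rw [Matrix.mul_smul, Matrix.smul_mul, ← smul_sub, Matrix.smul_mul, Matrix.trace_smul, hx,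
      smul_zero]

lemma iso4 (hα : Function.Injective α) (hA : A = Matrix.diagonal fun i => α (blk i))
    {M : Matrix (Fin n) (Fin n) ℝ} (hM : M ∈ vSet blk)
    {ξ η : Matrix (Fin n) (Fin n) ℝ} (hη : η ∈ jSet blk A M)
    (h : ∀ (lam : ℝ) (j : ℕ), ((M * η - η * M) * (M + lam • A) ^ j).trace = 0)
    (hξ : ξ ∈ Submodule.span ℝ (restrictedManakovGradients blk A M)) :
    (M * (ξ * η - η * ξ)).trace = 0 := by
  induction hξ using Submodule.span_induction with
  | mem x hx =>
    obtain ⟨mu, k, rfl⟩ := hx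
    have := tr_rel hα hA hM hη ((M + mu • A) ^ k)
    rw [h, neg_zero] at this
    exact this
  | zero => simp
  | add x y _ _ hx hy =>
    rw [show M * ((x + y) * η - η * (x + y)) = M * (x * η - η * x) + M * (y * η - η * y) by
      noncomm_ring, Matrix.trace_add, hx, hy, add_zero]
  | smul c x _ hx =>
    rw [Matrix.mul_smul, Matrix.smul_mul, ← smul_sub, Matrix.mul_smul, Matrix.trace_smul, hx,
      smul_zero]

end
end RMC

namespace RMC

section
variable {n r : ℕ}

/-- polynomial functions on matrices -/
def Pl (n : ℕ) : Subalgebra ℝ (Matrix (Fin n) (Fin n) ℝ → ℝ) :=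
  Algebra.adjoin ℝ (Set.range fun p : Fin n × Fin n => fun M => M p.1 p.2)

lemma Pl_cont {h : Matrix (Fin n) (Fin n) ℝ → ℝ} (hh : h ∈ Pl n) : Continuous h := by
  induction hh using Algebra.adjoin_induction with
  | mem x hx =>
    obtain ⟨p, rfl⟩ := hx
    exact continuous_id.matrix_elem p.1 p.2
  | algebraMap c => exact continuous_const
  | add x y _ _ hx hy => exact hx.add hy
  | mul x y _ _ hx hy => exact hx.mul hy

lemma Pl_line {h : Matrix (Fin n) (Fin n) ℝ → ℝ} (hh : h ∈ Pl n) (M D : Matrix (Fin n) (Fin n) ℝ) :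
    ∃ p : Polynomial ℝ, ∀ t : ℝ, h (M + t • D) = p.eval t := by
  induction hh using Algebra.adjoin_induction with
  | mem x hx =>
    obtain ⟨p, rfl⟩ := hx
    exact ⟨Polynomial.C (M p.1 p.2) + Polynomial.X * Polynomial.C (D p.1 p.2), by
      intro t; simp; exact mul_comm _ _⟩
  | algebraMap c => exact ⟨Polynomial.C c, by simp [Pi.algebraMap_apply]⟩
  | add x y _ _ hx hy =>
    obtain ⟨p, hp⟩ := hx
    obtain ⟨q, hq⟩ := hy
    exact ⟨p + q, by simp [hp, hq]⟩
  | mul x y _ _ hx hy =>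
    obtain ⟨p, hp⟩ := hx
    obtain ⟨q, hq⟩ := hy
    exact ⟨p * q, by simp [hp, hq]⟩

lemma Pl_const (c : ℝ) : (fun _ => c) ∈ Pl n := (Pl n).algebraMap_mem c

lemma Pl_open {blk : Fin n → Fin r} {h : Matrix (Fin n) (Fin n) ℝ → ℝ} (hh : h ∈ Pl n) :
    IsOpen {M : {X : Matrix (Fin n) (Fin n) ℝ // X ∈ vSet blk} | h M.1 ≠ 0} :=
  isOpen_ne.preimage ((Pl_cont hh).comp continuous_subtype_val)

lemma vSet_line {blk : Fin n → Fin r} {M D : Matrix (Fin n) (Fin n) ℝ} (hM : M ∈ vSet blk)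
    (hD : D ∈ vSet blk) (t : ℝ) : M + t • (D - M) ∈ vSet blk := by
  constructor
  · rw [Matrix.transpose_add, Matrix.transpose_smul, Matrix.transpose_sub, hM.1, hD.1,
      neg_add, ← smul_neg]
    congr 2; abel
  · intro i j hij
    simp [hM.2 i j hij, hD.2 i j hij]

lemma Pl_dense {blk : Fin n → Fin r} {h : Matrix (Fin n) (Fin n) ℝ → ℝ} (hh : h ∈ Pl n)
    {M0 : Matrix (Fin n) (Fin n) ℝ} (hM0 : M0 ∈ vSet blk) (h0 : h M0 ≠ 0) :
    Dense {M : {X : Matrix (Fin n) (Fin n) ℝ // X ∈ vSet blk} | h M.1 ≠ 0} := by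
  intro M
  obtain ⟨p, hp⟩ := Pl_line hh M.1 (M0 - M.1)
  have hp0 : p ≠ 0 := by
    rintro rfl
    have := hp 1
    simp at this
    exact h0 this
  let γ : ℝ → {X : Matrix (Fin n) (Fin n) ℝ // X ∈ vSet blk} :=
    fun t => ⟨M.1 + t • (M0 - M.1), vSet_line M.2 hM0 t⟩
  have hγ : Continuous γ := by
    refine Continuous.subtype_mk ?_ _
    exact continuous_const.add (continuous_id.smul continuous_const)
  have hS : Dense {t : ℝ | p.eval t ≠ 0} := by
    have hf : {t : ℝ | p.IsRoot t}.Finite := Polynomial.finite_setOfPred_isRoot hp0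
    exact hf.countable.dense_compl ℝ
  have hγ0 : γ 0 = M := by apply Subtype.ext; simp [γ]
  rw [← hγ0]
  have h1 := image_closure_subset_closure_image hγ (s := {t : ℝ | p.eval t ≠ 0})
    ⟨0, hS 0, rfl⟩
  refine closure_mono ?_ h1
  rintro _ ⟨t, ht, rfl⟩
  change h (M.1 + t • (M0 - M.1)) ≠ 0
  rw [hp t]; exact ht

/-- matrix-valued polynomial maps -/
def PlM (f : Matrix (Fin n) (Fin n) ℝ → Matrix (Fin n) (Fin n) ℝ) : Prop :=
  ∀ i j, (fun M => f M i j) ∈ Pl n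

lemma PlM_id : PlM (n := n) (fun M => M) := fun i j => Algebra.subset_adjoin ⟨(i, j), rfl⟩

lemma PlM_const (X : Matrix (Fin n) (Fin n) ℝ) : PlM (fun _ => X) := fun i j => Pl_const _

lemma PlM_add {f g : Matrix (Fin n) (Fin n) ℝ → Matrix (Fin n) (Fin n) ℝ} (hf : PlM f)
    (hg : PlM g) : PlM (fun M => f M + g M) := fun i j => add_mem (hf i j) (hg i j)

lemma PlM_sub {f g : Matrix (Fin n) (Fin n) ℝ → Matrix (Fin n) (Fin n) ℝ} (hf : PlM f)
    (hg : PlM g) : PlM (fun M => f M - g M) := fun i j => sub_mem (hf i j) (hg i j)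

lemma PlM_mul {f g : Matrix (Fin n) (Fin n) ℝ → Matrix (Fin n) (Fin n) ℝ} (hf : PlM f)
    (hg : PlM g) : PlM (fun M => f M * g M) := fun i j => by
  have : (fun M => (f M * g M) i j) = ∑ k, (fun M => f M i k) * (fun M => g M k j) := by
    funext M
    simp [Matrix.mul_apply]
  rw [this]
  exact sum_mem fun k _ => mul_mem (hf i k) (hg k j)

lemma PlM_pow {f : Matrix (Fin n) (Fin n) ℝ → Matrix (Fin n) (Fin n) ℝ} (hf : PlM f) (k : ℕ) :
    PlM (fun M => f M ^ k) := by
  induction k with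
  | zero => simpa using PlM_const 1
  | succ k ih => simp only [pow_succ]; exact PlM_mul ih hf

lemma PlM_trace {f : Matrix (Fin n) (Fin n) ℝ → Matrix (Fin n) (Fin n) ℝ} (hf : PlM f) :
    (fun M => (f M).trace) ∈ Pl n := by
  have : (fun M => (f M).trace) = ∑ k, (fun M => f M k k) := by
    funext M
    simp [Matrix.trace]
  rw [this]
  exact sum_mem fun k _ => hf k k

lemma PlM_bp (blk : Fin n → Fin r) {f : Matrix (Fin n) (Fin n) ℝ → Matrix (Fin n) (Fin n) ℝ}
    (hf : PlM f) : PlM (fun M => bp blk (f M)) := fun i j => by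
  simp only [bp_apply]
  split_ifs
  · exact hf i j
  · exact Pl_const 0

lemma PlM_qv (blk : Fin n → Fin r) {f : Matrix (Fin n) (Fin n) ℝ → Matrix (Fin n) (Fin n) ℝ}
    (hf : PlM f) : PlM (fun M => qv blk (f M)) := fun i j => by
  simp only [qv_apply]
  split_ifs
  · exact Pl_const 0
  · simp only [div_eq_mul_inv]
    exact mul_mem (sub_mem (hf i j) (hf j i)) (Pl_const _)

lemma Pl_det {ι : Type*} [Fintype ι] [DecidableEq ι]
    {f : Matrix (Fin n) (Fin n) ℝ → Matrix ι ι ℝ} (hf : ∀ i j, (fun M => f M i j) ∈ Pl n) :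
    (fun M => (f M).det) ∈ Pl n := by
  have : (fun M => (f M).det) = ∑ s : Equiv.Perm ι, (fun _ => (((Equiv.Perm.sign s : ℤˣ) : ℤ) : ℝ)) *
      ∏ i, (fun M => f M (s i) i) := by
    funext M
    simp [Matrix.det_apply']
  rw [this]
  exact sum_mem fun s _ => mul_mem (Pl_const _) (prod_mem fun i _ => hf _ _)

lemma Pl_indep {ι κ : Type*} [Fintype ι] [Fintype κ]
    {f : ι → Matrix (Fin n) (Fin n) ℝ → (κ → ℝ)} (hf : ∀ i c, (fun M => f i M c) ∈ Pl n)
    {M0 : Matrix (Fin n) (Fin n) ℝ} (h0 : LinearIndependent ℝ (fun i => f i M0)) :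
    ∃ h ∈ Pl n, h M0 ≠ 0 ∧ ∀ M, h M ≠ 0 → LinearIndependent ℝ (fun i => f i M) := by
  classical
  obtain ⟨φ, hφ⟩ := LinearMap.exists_leftInverse_of_injective
    (Fintype.linearCombination ℝ (fun i => f i M0))
    (LinearMap.ker_eq_bot.mpr (h0.fintypeLinearCombination_injective))
  have hφ' : ∀ i, φ (f i M0) = Pi.single i 1 := by
    intro i
    have := LinearMap.congr_fun hφ (Pi.single i 1)
    simpa using this
  refine ⟨fun M => (Matrix.of fun i j => φ (f i M) j).det, Pl_det fun i j => ?_, ?_, ?_⟩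
  · have : (fun M => (Matrix.of fun i j => φ (f i M) j) i j) =
        ∑ c, (fun M => f i M c) * (fun _ => φ (Pi.single c 1) j) := by
      funext M
      rw [Matrix.of_apply, LinearMap.pi_apply_eq_sum_univ φ (f i M)]
      simp [Pi.single_apply, Finset.sum_apply]
      refine Finset.sum_congr rfl fun c _ => ?_
      have : (fun j => if c = j then (1 : ℝ) else 0) = Pi.single c 1 := by
        funext d
        simp [Pi.single_apply, eq_comm]
      rw [this]
    rw [this]
    exact sum_mem fun c _ => mul_mem (hf i c) (Pl_const _)
  · have : (Matrix.of fun i j => φ (f i M0) j) = 1 := by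
      ext i j
      rw [Matrix.of_apply, hφ', Matrix.one_apply, Pi.single_apply]
      simp [eq_comm]
    simp only [this, Matrix.det_one]; exact one_ne_zero
  · intro M hM
    have := Matrix.linearIndependent_rows_of_det_ne_zero hM
    exact LinearIndependent.of_comp φ this

end
end RMC

namespace RMC

section
variable {n r : ℕ} {blk : Fin n → Fin r} {α : Fin r → ℝ} {A : Matrix (Fin n) (Fin n) ℝ}

/-- flattening of matrices -/
def unc (n : ℕ) : Matrix (Fin n) (Fin n) ℝ →ₗ[ℝ] (Fin n × Fin n → ℝ) where
  toFun X := fun p => X p.1 p.2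
  map_add' _ _ := rfl
  map_smul' _ _ := rfl

lemma unc_ker : LinearMap.ker (unc n) = ⊥ := by
  rw [LinearMap.ker_eq_bot]
  intro X Y h
  ext i j
  exact congrFun h (i, j)

/-- commutator with `M` -/
def adM (M : Matrix (Fin n) (Fin n) ℝ) :
    Matrix (Fin n) (Fin n) ℝ →ₗ[ℝ] Matrix (Fin n) (Fin n) ℝ where
  toFun x := M * x - x * M
  map_add' x y := by noncomm_ring
  map_smul' c x := by
    rw [Matrix.mul_smul, Matrix.smul_mul, ← smul_sub]; rfl

/-- the linear system cutting out the commutant -/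
noncomputable def TT {β : Type*} (blk : Fin n → Fin r) (A : Matrix (Fin n) (Fin n) ℝ)
    (l : β → ℝ) (k : β → ℕ) (M : Matrix (Fin n) (Fin n) ℝ) :
    Matrix (Fin n) (Fin n) ℝ →ₗ[ℝ] ((Fin n × Fin n) ⊕ (Fin n × Fin n) ⊕ β → ℝ) :=
  LinearMap.pi (Sum.elim
    (fun p => LinearMap.proj p ∘ₗ unc n ∘ₗ (LinearMap.id - qv blk))
    (Sum.elim (fun p => LinearMap.proj p ∘ₗ unc n ∘ₗ bp blk ∘ₗ adM M)
      (fun i => Matrix.traceLinearMap (Fin n) ℝ ℝ ∘ₗ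
        LinearMap.mulRight ℝ ((M + l i • A) ^ (k i)) ∘ₗ adM M)))

lemma TT_eq_zero {β : Type*} {l : β → ℝ} {k : β → ℕ} {M η : Matrix (Fin n) (Fin n) ℝ} :
    TT blk A l k M η = 0 ↔ η = qv blk η ∧ bp blk (M * η - η * M) = 0 ∧
      ∀ i, ((M * η - η * M) * (M + l i • A) ^ (k i)).trace = 0 := by
  constructor
  · intro h
    refine ⟨?_, ?_, ?_⟩
    · ext i j
      have := congrFun h (Sum.inl (i, j))
      exact sub_eq_zero.mp this
    · ext i j
      exact congrFun h (Sum.inr (Sum.inl (i, j)))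
    · intro i
      exact congrFun h (Sum.inr (Sum.inr i))
  · rintro ⟨h1, h2, h3⟩
    funext x
    rcases x with ⟨i, j⟩ | ⟨i, j⟩ | i
    · exact sub_eq_zero.mpr (congrFun (congrFun h1 i) j)
    · exact congrFun (congrFun h2 i) j
    · exact h3 i

lemma TT_Pl {β : Type*} (l : β → ℝ) (k : β → ℕ) (η : Matrix (Fin n) (Fin n) ℝ)
    (x : (Fin n × Fin n) ⊕ (Fin n × Fin n) ⊕ β) :
    (fun M => TT blk A l k M η x) ∈ Pl n := by
  have h1 : PlM (fun M : Matrix (Fin n) (Fin n) ℝ => M * η - η * M) :=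
    PlM_sub (PlM_mul PlM_id (PlM_const η)) (PlM_mul (PlM_const η) PlM_id)
  rcases x with ⟨i, j⟩ | ⟨i, j⟩ | i
  · exact Pl_const _
  · exact PlM_bp blk h1 i j
  · exact PlM_trace (PlM_mul h1 (PlM_pow (PlM_add PlM_id (PlM_const (l i • A))) (k i)))

lemma mem_j_of (hα : Function.Injective α) (hA : A = Matrix.diagonal fun i => α (blk i))
    {M η : Matrix (Fin n) (Fin n) ℝ} (h1 : η = qv blk η) (h2 : bp blk (M * η - η * M) = 0) :
    η ∈ jSet blk A M := by
  refine ⟨by rw [h1]; exact qv_mem _, fun X _ hXA => ?_⟩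
  have hX := (comm_iff hα hA X).mp hXA.symm
  simp only [Matrix.trace, Matrix.diag, Matrix.mul_apply (M := M * η - η * M)]
  refine Finset.sum_eq_zero fun i _ => Finset.sum_eq_zero fun j _ => ?_
  by_cases hij : blk i = blk j
  · have := congrFun (congrFun h2 i) j
    rw [bp_apply, if_pos hij, Matrix.zero_apply] at this
    rw [this, zero_mul]
  · rw [hX j i (Ne.symm hij), mul_zero]

lemma generic (hα : Function.Injective α) (hA : A = Matrix.diagonal fun i => α (blk i))
    {M0 : Matrix (Fin n) (Fin n) ℝ} (hM0 : M0 ∈ vSet blk) (hS : SS blk A M0) :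
    ∃ U : Set {X : Matrix (Fin n) (Fin n) ℝ // X ∈ vSet blk},
      IsOpen U ∧ Dense U ∧ ∀ M ∈ U, SS blk A M.1 := by
  classical
  obtain ⟨b, hb1, hb2, hb3⟩ := exists_linearIndependent ℝ (restrictedManakovGradients blk A M0)
  have hbf : Finite b := hb3.finite
  have := Fintype.ofFinite b
  choose l k hlk using fun i : b => hb1 i.2
  have hlk' : ∀ i : b, (i : Matrix (Fin n) (Fin n) ℝ) = qv blk ((M0 + l i • A) ^ k i) := hlk
  set V0 := Submodule.span ℝ (restrictedManakovGradients blk A M0) with hV0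
  obtain ⟨W, hW⟩ := Submodule.exists_isCompl V0
  let c : Fin (Module.finrank ℝ W) → Matrix (Fin n) (Fin n) ℝ := fun i => (Module.finBasis ℝ W i : W)
  have hc : LinearIndependent ℝ c :=
    (Module.finBasis ℝ W).linearIndependent.map' W.subtype W.ker_subtype
  have hcW : Submodule.span ℝ (Set.range c) ≤ W := by
    rw [Submodule.span_le]
    rintro _ ⟨i, rfl⟩
    exact (Module.finBasis ℝ W i).2
  have hker : LinearMap.ker (TT blk A l k M0) ≤ V0 := by
    intro η hη
    rw [LinearMap.mem_ker, TT_eq_zero] at hη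
    obtain ⟨h1, h2, h3⟩ := hη
    have hj := mem_j_of hα hA h1 h2
    refine hS η hj fun lam j => ?_
    have hq : qv blk ((M0 + lam • A) ^ j) ∈ Submodule.span ℝ b := by
      rw [hb2]; exact Submodule.subset_span ⟨lam, j, rfl⟩
    have h4 : ∀ ξ ∈ Submodule.span ℝ b, (M0 * (ξ * η - η * ξ)).trace = 0 := by
      intro ξ hξ
      induction hξ using Submodule.span_induction with
      | mem x hx =>
        have h5 := tr_rel hα hA hM0 hj ((M0 + l ⟨x, hx⟩ • A) ^ k ⟨x, hx⟩)
        rw [h3, neg_zero, ← hlk' ⟨x, hx⟩] at h5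
        exact h5
      | zero => simp
      | add x y _ _ hx hy =>
        rw [show M0 * ((x + y) * η - η * (x + y)) = M0 * (x * η - η * x) + M0 * (y * η - η * y) by
          noncomm_ring, Matrix.trace_add, hx, hy, add_zero]
      | smul c x _ hx =>
        rw [Matrix.mul_smul, Matrix.smul_mul, ← smul_sub, Matrix.mul_smul, Matrix.trace_smul, hx,
          smul_zero]
    have h5 := h4 _ hq
    rw [tr_rel hα hA hM0 hj, neg_eq_zero] at h5
    exact h5
  have hTc : LinearIndependent ℝ (fun i => TT blk A l k M0 (c i)) :=
    hc.map (hW.disjoint.symm.mono hcW hker)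
  obtain ⟨h1, h1P, h10, h1i⟩ := Pl_indep (f := fun i M => TT blk A l k M (c i))
    (fun i x => TT_Pl l k (c i) x) hTc
  obtain ⟨h2, h2P, h20, h2i⟩ := Pl_indep (f := fun (i : b) M => unc n (qv blk ((M + l i • A) ^ k i)))
    (fun i x => PlM_qv blk (PlM_pow (PlM_add PlM_id (PlM_const (l i • A))) (k i)) x.1 x.2)
    (M0 := M0) (by
      have := hb3.map' (unc n) unc_ker
      simp only [← hlk']
      exact this)
  refine ⟨_, (Pl_open h1P).inter (Pl_open h2P),
    (Pl_dense h1P hM0 h10).inter_of_isOpen_left (Pl_dense h2P hM0 h20) (Pl_open h1P), ?_⟩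
  rintro ⟨M, hM⟩ ⟨hM1, hM2⟩ η hη htr
  have i1 := h1i M hM1
  have i2 : LinearIndependent ℝ (fun i : b => qv blk ((M + l i • A) ^ k i)) :=
    LinearIndependent.of_comp (unc n) (h2i M hM2)
  set G := Submodule.span ℝ (Set.range fun i : b => qv blk ((M + l i • A) ^ k i)) with hG
  have hGT : G ≤ LinearMap.ker (TT blk A l k M) := by
    rw [hG, Submodule.span_le]
    rintro _ ⟨i, rfl⟩
    rw [SetLike.mem_coe, LinearMap.mem_ker, TT_eq_zero]
    exact ⟨(qv_of_mem (qv_mem _)).symm, bp_j hα hA hM (gen_mem_j hα hA hM _ _),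
      fun _ => iso2 hα hA hM _ _ _ _⟩
  have hGF : G ≤ Submodule.span ℝ (restrictedManakovGradients blk A M) := by
    rw [hG]
    refine Submodule.span_mono ?_
    rintro _ ⟨i, rfl⟩
    exact ⟨_, _, rfl⟩
  have hdim : Module.finrank ℝ (LinearMap.ker (TT blk A l k M)) ≤ Module.finrank ℝ G := by
    have d1 := LinearMap.finrank_range_add_finrank_ker (TT blk A l k M)
    have d2 := Submodule.finrank_add_eq_of_isCompl hW
    have d3 : Module.finrank ℝ G = Fintype.card b := finrank_span_eq_card i2
    have d4 : Module.finrank ℝ V0 = Fintype.card b := by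
      have := finrank_span_eq_card hb3
      rw [Subtype.range_coe, hb2] at this
      exact this
    have d5 := finrank_span_eq_card i1
    rw [Fintype.card_fin] at d5
    have d6 : Submodule.span ℝ (Set.range fun i => TT blk A l k M (c i)) ≤
        LinearMap.range (TT blk A l k M) := by
      rw [Submodule.span_le]
      rintro _ ⟨i, rfl⟩
      exact ⟨_, rfl⟩
    have d7 := Submodule.finrank_mono d6
    omega
  have hGe := Submodule.eq_of_le_of_finrank_le hGT hdim
  apply hGF
  rw [hGe, LinearMap.mem_ker, TT_eq_zero]
  exact ⟨(qv_of_mem hη.1).symm, bp_j hα hA hM hη, fun i => htr _ _⟩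

end
end RMC

/-- Theorem 3(i) of the paper, valid for every choice of `k 1, …, k r`:
Let `A` be the block-scalar diagonal matrix with pairwise distinct values `α p` on
consecutive blocks of sizes `k 1, …, k r`, and for `M ∈ v` let `F_M` be the span of the
projections onto `v` of the matrices `π((M + λA)^j)`. Then there is an open dense
subset `U ⊆ v` such that for every `M ∈ U`: `F_M ⊆ j_M`, and
`{η ∈ j_M : tr(M·[ξ, η]) = 0 for all ξ ∈ F_M} = F_M`, i.e. the restricted Manakov
integrals form a complete commutative family of `Ad_{SO(n)_A}`-invariant polynomials
on `v`. -/
theorem restricted_manakov_complete (n r : ℕ) (k : Fin r → ℕ)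
    (hk : ∀ p, 0 < k p) (hsum : ∑ p, k p = n)
    (blk : Fin n → Fin r) (hmono : Monotone blk)
    (hcard : ∀ p, (Finset.univ.filter fun i => blk i = p).card = k p)
    (α : Fin r → ℝ) (hα : Function.Injective α)
    (A : Matrix (Fin n) (Fin n) ℝ) (hA : A = Matrix.diagonal fun i => α (blk i))
    (F : Matrix (Fin n) (Fin n) ℝ → Submodule ℝ (Matrix (Fin n) (Fin n) ℝ))
    (hF : ∀ M, F M = Submodule.span ℝ (restrictedManakovGradients blk A M)) :
    ∃ U : Set {X : Matrix (Fin n) (Fin n) ℝ // X ∈ vSet blk},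
      IsOpen U ∧ Dense U ∧
      ∀ M ∈ U,
        (↑(F M.1) ⊆ jSet blk A M.1) ∧
        {η ∈ jSet blk A M.1 |
            ∀ ξ ∈ F M.1, ((M.1 : Matrix (Fin n) (Fin n) ℝ) * (ξ * η - η * ξ)).trace = 0}
          = ↑(F M.1) := by
  obtain ⟨M0, hM0, hS⟩ := RMC.exists_SS blk hmono α hα A hA
  obtain ⟨U, hU1, hU2, hU3⟩ := RMC.generic hα hA hM0 hS
  refine ⟨U, hU1, hU2, fun M hM => ?_⟩
  rw [hF]
  have hle := RMC.F_le_j hα hA M.2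
  refine ⟨hle, Set.Subset.antisymm ?_ ?_⟩
  · rintro η ⟨hη, hc⟩
    refine hU3 M hM η hη fun lam j => ?_
    have h1 := hc _ (Submodule.subset_span ⟨lam, j, rfl⟩)
    have h2 := RMC.tr_rel hα hA M.2 hη ((M.1 + lam • A) ^ j)
    exact neg_eq_zero.mp (h2.symm.trans h1)
  · intro η hη
    exact ⟨hle hη, fun ξ hξ => RMC.iso4 hα hA M.2 (hle hη)
      (fun lam j => RMC.iso3 hα hA M.2 hη lam j) hξ⟩
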